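/- Suppose char K = 2 and dim V ≡ 2 (mod 4). Let φ ∈ SO(V,Q). Then φ is a product of two involutions of SO(V,Q) if and only if there exists a nonzero φ-invariant subspace U of V on which the restriction of f_Q is nondegenerate such that the restriction ψ = φ|_U is unipotent and either (a) ψ is cyclic, or (b) ψ is orthogonally indecomposable as an element of O(U, Q|_U) and dim U ≡ 2 (mod 4). -/

import Mathlib

open Polynomial Module

variable {K V : Type*}

section Defs

variable [Field K] [AddCommGroup V] [Module K V]

/-- The polar form `f_Q(u,w) = Q(u+w) - Q u - Q w` of a quadratic form. -/
def polarF (Q : QuadraticForm K V) (u w : V) : K := Q (u + w) - Q u - Q w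

/-- `Q` is nondefective: its polar form is nondegenerate. -/
def Nondefective (Q : QuadraticForm K V) : Prop :=
  ∀ u : V, (∀ w : V, polarF Q u w = 0) → u = 0

/-- Membership in the orthogonal group `O(V,Q)`. -/
def InO (Q : QuadraticForm K V) (φ : V ≃ₗ[K] V) : Prop := ∀ v : V, Q (φ v) = Q v

/-- Membership in the special orthogonal group `SO(V,Q)`:
orthogonal and `dim im(φ - 1)` is even. -/
def InSO (Q : QuadraticForm K V) (φ : V ≃ₗ[K] V) : Prop :=
  InO Q φ ∧ Even (Module.finrank K (LinearMap.range (φ.toLinearMap - LinearMap.id)))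

/-- `φ` is a product of two involutions of `SO(V,Q)`. -/
def BireflSO (Q : QuadraticForm K V) (φ : V ≃ₗ[K] V) : Prop :=
  ∃ σ τ : V ≃ₗ[K] V, InSO Q σ ∧ InSO Q τ ∧ σ * σ = 1 ∧ τ * τ = 1 ∧ φ = σ * τ

/-- A subspace is totally isotropic if `Q` vanishes on it. -/
def TotIsotropic (Q : QuadraticForm K V) (U : Submodule K V) : Prop := ∀ u ∈ U, Q u = 0

/-- A subspace invariant under a linear map. -/
def Invariant (f : V →ₗ[K] V) (U : Submodule K V) : Prop := ∀ u ∈ U, f u ∈ U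

/-- The restriction of the polar form of `Q` to `U` is nondegenerate. -/
def NondegOn (Q : QuadraticForm K V) (U : Submodule K V) : Prop :=
  ∀ u ∈ U, (∀ w ∈ U, polarF Q u w = 0) → u = 0

/-- `f` is orthogonally indecomposable: no invariant subspace `W` with
`0 < dim W < dim V` on which the polar form of `Q` is nondegenerate. -/
def OrthIndec (Q : QuadraticForm K V) (f : V →ₗ[K] V) : Prop :=
  ¬ ∃ W : Submodule K V, Invariant f W ∧ 0 < Module.finrank K W ∧
      Module.finrank K W < Module.finrank K V ∧ NondegOn Q W

/-- The subspace spanned by the `f`-orbit of `x`. -/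
def cyclicSpan (f : V →ₗ[K] V) (x : V) : Submodule K V :=
  Submodule.span K (Set.range fun k : ℕ => (f ^ k) x)

/-- `f` is a cyclic linear map. -/
def IsCyclicEnd (f : V →ₗ[K] V) : Prop := ∃ x : V, cyclicSpan f x = ⊤

/-- `f` is of type 1 with exponent `m`: orthogonally indecomposable, bicyclic, and
with minimal polynomial `(X - 1) ^ m`. -/
def IsType1 (Q : QuadraticForm K V) (f : V →ₗ[K] V) (m : ℕ) : Prop :=
  OrthIndec Q f ∧ 1 ≤ m ∧ minpoly K f = (X - 1) ^ m ∧
    ∃ x z : V, IsCompl (cyclicSpan f x) (cyclicSpan f z)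

/-- Type 1o: type 1 with odd exponent. -/
def IsType1o (Q : QuadraticForm K V) (f : V →ₗ[K] V) : Prop :=
  ∃ m : ℕ, IsType1 Q f m ∧ Odd m

/-- Type 1e: type 1 with even exponent. -/
def IsType1e (Q : QuadraticForm K V) (f : V →ₗ[K] V) : Prop :=
  ∃ m : ℕ, IsType1 Q f m ∧ Even m

/-- The quadratic space `(V,Q)` is hyperbolic. -/
def HyperbolicSpace (Q : QuadraticForm K V) : Prop :=
  ∃ U W : Submodule K V, TotIsotropic Q U ∧ TotIsotropic Q W ∧ IsCompl U W

/-- The transformation `f` is hyperbolic: `V` is a direct sum of two totally isotropic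
`f`-invariant subspaces. -/
def HyperbolicMap (Q : QuadraticForm K V) (f : V →ₗ[K] V) : Prop :=
  ∃ U W : Submodule K V, TotIsotropic Q U ∧ TotIsotropic Q W ∧
    Invariant f U ∧ Invariant f W ∧ IsCompl U W

/-- `f` is semisimple: every invariant subspace has an invariant complement. -/
def SemisimpleEnd (f : V →ₗ[K] V) : Prop :=
  ∀ U : Submodule K V, Invariant f U → ∃ W : Submodule K V, Invariant f W ∧ IsCompl U W

end Defs

theorem Submodule.finrank_map_add_finrank_inf_ker {K V W : Type*} [Field K] [AddCommGroup V]
    [Module K V] [FiniteDimensional K V] [AddCommGroup W] [Module K W]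
    (f : V →ₗ[K] W) (X : Submodule K V) :
    finrank K (X.map f) + finrank K (X ⊓ LinearMap.ker f : Submodule K V) = finrank K X := by
  have h := LinearMap.finrank_range_add_finrank_ker (f.domRestrict X)
  rw [LinearMap.range_domRestrict, LinearMap.ker_domRestrict] at h
  rw [← h, ← Submodule.finrank_map_subtype_eq X, Submodule.map_comap_subtype]

/-- The dimension of `X` and that of the radical of an alternating form on `X` have the same
parity. -/
theorem even_finrank_add_finrank_radical {K W : Type*} [Field K] [AddCommGroup W] [Module K W]
    [FiniteDimensional K W] (β : LinearMap.BilinForm K W) (X : Submodule K W)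
    (hβ : ∀ x ∈ X, β x x = 0) :
    Even (finrank K X + finrank K (X ⊓ β.orthogonal X : Submodule K W)) := by
  induction hn : finrank K X using Nat.strong_induction_on generalizing X with
  | _ n ih =>
  by_cases h : ∀ x ∈ X, ∀ y ∈ X, β x y = 0
  · have : X ⊓ β.orthogonal X = X := by
      rw [inf_eq_left]
      intro y hy
      rw [LinearMap.BilinForm.mem_orthogonal_iff]
      exact fun x hx => h x hx y hy
    rw [this, hn]
    exact Even.add_self n
  · push Not at h
    obtain ⟨x, hx, y, hy, hxy⟩ := h
    have hxx : β x x = 0 := hβ x hx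
    have hyy : β y y = 0 := hβ y hy
    have hyx : β y x ≠ 0 := by
      have := hβ (x + y) (X.add_mem hx hy)
      simp only [map_add, LinearMap.add_apply, hxx, hyy, zero_add, add_zero] at this
      intro h0
      rw [h0, zero_add] at this
      exact hxy this
    let g : X →ₗ[K] K × K := ((β x).prod (β y)).comp X.subtype
    have hg : Function.Surjective g := by
      rintro ⟨a, b⟩
      refine ⟨(a / β x y) • ⟨y, hy⟩ + (b / β y x) • ⟨x, hx⟩, ?_⟩
      simp [g, hxx, hyy, hxy, hyx]
    let X' : Submodule K W := (LinearMap.ker g).map X.subtype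
    have hX' : ∀ v, v ∈ X' ↔ v ∈ X ∧ β x v = 0 ∧ β y v = 0 := by
      intro v
      simp [X', g]
      tauto
    have hle : X' ≤ X := fun v hv => ((hX' v).1 hv).1
    have hfin : finrank K X = finrank K X' + 2 := by
      have h1 := LinearMap.finrank_range_add_finrank_ker g
      rw [LinearMap.range_eq_top.2 hg, finrank_top] at h1
      have h2 : finrank K X' = finrank K (LinearMap.ker g) :=
        Submodule.finrank_map_subtype_eq X _
      simp at h1
      omega
    have hrad : X' ⊓ β.orthogonal X' = X ⊓ β.orthogonal X := by
      ext v
      simp only [Submodule.mem_inf, hX', LinearMap.BilinForm.mem_orthogonal_iff]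
      constructor
      · rintro ⟨⟨hv, hxv, hyv⟩, hv'⟩
        refine ⟨hv, fun w hw => ?_⟩
        have := hv' (w - (β x w / β x y) • y - (β y w / β y x) • x) ⟨?_, ?_, ?_⟩
        · simpa [hxv, hyv] using this
        · exact X.sub_mem (X.sub_mem hw (X.smul_mem _ hy)) (X.smul_mem _ hx)
        · simp [hxx, hxy]
        · simp [hyy, hyx]
      · rintro ⟨hv, hv'⟩
        exact ⟨⟨hv, hv' x hx, hv' y hy⟩, fun w hw => hv' w hw.1⟩
    have := ih (finrank K X') (by omega) X' (fun v hv => hβ v (hle hv)) rfl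
    rw [hrad] at this
    rw [← hn, hfin]
    rw [Nat.even_iff] at this ⊢
    omega

section Lagrangians

variable {K E : Type*} [Field K] [AddCommGroup E] [Module K E]
  (q : QuadraticForm K E)

theorem polarBilin_eq_zero_of_singular {L : Submodule K E} (hL : ∀ x ∈ L, q x = 0) {x y : E}
    (hx : x ∈ L) (hy : y ∈ L) : q.polarBilin x y = 0 := by
  simp [QuadraticMap.polar, hL _ (L.add_mem hx hy), hL _ hx, hL _ hy]

theorem isRefl_polarBilin : q.polarBilin.IsRefl := by
  intro x y h
  rw [QuadraticMap.polarBilin_apply_apply] at h ⊢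
  rwa [QuadraticMap.polar_comm]

variable [FiniteDimensional K E]

theorem orthogonal_eq_self_of_singular (hq : q.polarBilin.Nondegenerate) {L : Submodule K E}
    (hL : ∀ x ∈ L, q x = 0) (hd : 2 * finrank K L = finrank K E) :
    LinearMap.BilinForm.orthogonal q.polarBilin L = L := by
  symm
  apply Submodule.eq_of_le_of_finrank_eq
  · intro x hx
    rw [LinearMap.BilinForm.mem_orthogonal_iff]
    exact fun y hy => polarBilin_eq_zero_of_singular q hL hy hx
  · rw [LinearMap.BilinForm.finrank_orthogonal hq]
    omega

/-- For three maximal totally singular subspaces of a hyperbolic space, the sum of the dimensions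
of the pairwise intersections has the same parity as the Witt index. -/
theorem even_finrank_inf_of_singular (hq : q.polarBilin.Nondegenerate) {L₁ L₂ L₃ : Submodule K E}
    (h₁ : ∀ x ∈ L₁, q x = 0) (h₂ : ∀ x ∈ L₂, q x = 0) (h₃ : ∀ x ∈ L₃, q x = 0)
    (d₁ : 2 * finrank K L₁ = finrank K E) (d₂ : 2 * finrank K L₂ = finrank K E)
    (d₃ : 2 * finrank K L₃ = finrank K E) :
    Even (finrank K L₁ + finrank K (L₁ ⊓ L₂ : Submodule K E) +
      finrank K (L₁ ⊓ L₃ : Submodule K E) + finrank K (L₂ ⊓ L₃ : Submodule K E)) := by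
  set B := q.polarBilin with hB
  have hr : B.IsRefl := isRefl_polarBilin q
  have o₁ := orthogonal_eq_self_of_singular q hq h₁ d₁
  have o₂ := orthogonal_eq_self_of_singular q hq h₂ d₂
  have o₃ := orthogonal_eq_self_of_singular q hq h₃ d₃
  have orth_sup : ∀ X Y : Submodule K E, LinearMap.BilinForm.orthogonal B (X ⊔ Y) =
      LinearMap.BilinForm.orthogonal B X ⊓ LinearMap.BilinForm.orthogonal B Y := by
    intro X Y
    apply le_antisymm
    · exact le_inf (LinearMap.BilinForm.orthogonal_le le_sup_left)
        (LinearMap.BilinForm.orthogonal_le le_sup_right)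
    · rintro v ⟨hv, hv'⟩
      rw [LinearMap.BilinForm.mem_orthogonal_iff]
      intro w hw
      obtain ⟨x, hx, y, hy, rfl⟩ := Submodule.mem_sup.1 hw
      have e1 : B x v = 0 := hv x hx
      have e2 : B y v = 0 := hv' y hy
      show B (x + y) v = 0
      rw [map_add, LinearMap.add_apply, e1, e2, add_zero]
  let W : Submodule K (E × E) :=
    L₂.prod L₃ ⊓ L₁.comap (LinearMap.coprod LinearMap.id LinearMap.id)
  have hW : ∀ p, p ∈ W ↔ (p.1 ∈ L₂ ∧ p.2 ∈ L₃) ∧ p.1 + p.2 ∈ L₁ := by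
    intro p
    simp [W, Submodule.mem_prod]
  let β : LinearMap.BilinForm K (E × E) :=
    B.compl₁₂ (LinearMap.fst K E E) (LinearMap.snd K E E)
  have hβ : ∀ p p', β p p' = B p.1 p'.2 := fun p p' => rfl
  have halt : ∀ p ∈ W, β p p = 0 := by
    intro p hp
    obtain ⟨⟨hp2, hp3⟩, hp1⟩ := (hW p).1 hp
    rw [hβ, hB, QuadraticMap.polarBilin_apply_apply, QuadraticMap.polar, h₁ _ hp1, h₂ _ hp2,
      h₃ _ hp3]
    simp
  have heven := even_finrank_add_finrank_radical β W halt
  let M : Submodule K (E × E) :=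
    (L₂ ⊓ L₃).map (LinearMap.prod LinearMap.id (-LinearMap.id))
  let M' : Submodule K (E × E) := (L₁ ⊓ L₂).prod (L₁ ⊓ L₃)
  have hM : ∀ p, p ∈ M ↔ (p.1 ∈ L₂ ∧ p.1 ∈ L₃) ∧ p.2 = -p.1 := by
    rintro ⟨x, y⟩
    simp only [M, Submodule.mem_map, Submodule.mem_inf]
    constructor
    · rintro ⟨z, hz, hzz⟩
      simp at hzz
      obtain ⟨rfl, rfl⟩ := hzz
      exact ⟨hz, rfl⟩
    · rintro ⟨hz, hzz⟩
      exact ⟨x, hz, Prod.ext rfl hzz.symm⟩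
  have hrad : W ⊓ β.orthogonal W = M ⊔ M' := by
    apply le_antisymm
    · rintro ⟨x, y⟩ ⟨hxy, hxy'⟩
      obtain ⟨⟨hx2, hy3⟩, hxy1⟩ := (hW _).1 hxy
      simp only at hx2 hy3 hxy1
      have hy : y ∈ LinearMap.BilinForm.orthogonal B
          (LinearMap.BilinForm.orthogonal B (L₂ ⊔ (L₁ ⊓ L₃))) := by
        rw [orth_sup, o₂, LinearMap.BilinForm.mem_orthogonal_iff]
        rintro z ⟨hz2, hz⟩
        have hz' : z ∈ L₁ ⊔ L₃ := by
          rw [← LinearMap.BilinForm.orthogonal_orthogonal hq hr (L₁ ⊔ L₃), orth_sup, o₁, o₃]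
          exact hz
        obtain ⟨r, hr1, s, hs3, rfl⟩ := Submodule.mem_sup.1 hz'
        refine hxy' (r + s, -s) ((hW _).2 ⟨⟨hz2, L₃.neg_mem hs3⟩, ?_⟩)
        simpa using hr1
      rw [LinearMap.BilinForm.orthogonal_orthogonal hq hr] at hy
      obtain ⟨p, hp, r, hr', rfl⟩ := Submodule.mem_sup.1 hy
      have hp3 : p ∈ L₃ := by simpa using L₃.sub_mem hy3 hr'.2
      refine Submodule.mem_sup.2 ⟨(-p, p), (hM _).2 ⟨⟨L₂.neg_mem hp, L₃.neg_mem hp3⟩, by simp⟩,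
        (x + p, r), ⟨⟨?_, L₂.add_mem hx2 hp⟩, hr'⟩, by simp⟩
      have := L₁.sub_mem hxy1 hr'.1
      rwa [← add_assoc, add_sub_cancel_right] at this
    · apply sup_le
      · rintro p hp
        obtain ⟨⟨hp2, hp3⟩, hpp⟩ := (hM p).1 hp
        refine ⟨(hW p).2 ⟨⟨hp2, by rw [hpp]; exact L₃.neg_mem hp3⟩, by simp [hpp]⟩, ?_⟩
        refine (LinearMap.BilinForm.mem_orthogonal_iff).2 ?_
        intro p' hp'
        obtain ⟨⟨hp2', -⟩, -⟩ := (hW _).1 hp'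
        show B p'.1 p.2 = 0
        rw [hpp, map_neg, polarBilin_eq_zero_of_singular q h₂ hp2' hp2, neg_zero]
      · rintro p ⟨⟨ha, hb⟩, hc, hd⟩
        refine ⟨(hW p).2 ⟨⟨hb, hd⟩, L₁.add_mem ha hc⟩, ?_⟩
        refine (LinearMap.BilinForm.mem_orthogonal_iff).2 ?_
        intro p' hp'
        obtain ⟨⟨hp2', hp3'⟩, hp1'⟩ := (hW _).1 hp'
        show B p'.1 p.2 = 0
        have e1 : B (p'.1 + p'.2) p.2 = 0 := polarBilin_eq_zero_of_singular q h₁ hp1' hc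
        have e2 : B p'.2 p.2 = 0 := polarBilin_eq_zero_of_singular q h₃ hp3' hd
        rw [map_add, LinearMap.add_apply, e2, add_zero] at e1
        exact e1
  have inj_antidiag : Function.Injective
      (LinearMap.prod LinearMap.id (-LinearMap.id) : E →ₗ[K] E × E) := by
    intro a b hab
    exact congrArg Prod.fst hab
  have inj_inr : Function.Injective (LinearMap.inr K E E) := LinearMap.inr_injective
  have fM : finrank K M = finrank K (L₂ ⊓ L₃ : Submodule K E) :=
    ((L₂ ⊓ L₃).equivMapOfInjective _ inj_antidiag).finrank_eq.symm
  have fM' : finrank K M' =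
      finrank K (L₁ ⊓ L₂ : Submodule K E) + finrank K (L₁ ⊓ L₃ : Submodule K E) := by
    have e1 : M'.map (LinearMap.fst K E E) = L₁ ⊓ L₂ := Submodule.prod_map_fst _ _
    have e2 : M' ⊓ LinearMap.ker (LinearMap.fst K E E) =
        (L₁ ⊓ L₃).map (LinearMap.inr K E E) := by
      ext ⟨a, b⟩
      simp only [M', Submodule.mem_inf, Submodule.mem_prod, LinearMap.mem_ker,
        LinearMap.fst_apply, Submodule.mem_map, LinearMap.inr_apply, Prod.mk.injEq]
      constructor
      · rintro ⟨⟨-, hb⟩, rfl⟩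
        exact ⟨b, hb, rfl, rfl⟩
      · rintro ⟨c, hc, rfl, rfl⟩
        exact ⟨⟨⟨L₁.zero_mem, L₂.zero_mem⟩, hc⟩, rfl⟩
    have e3 := Submodule.finrank_map_add_finrank_inf_ker (LinearMap.fst K E E) M'
    rw [e1, e2, ← ((L₁ ⊓ L₃).equivMapOfInjective _ inj_inr).finrank_eq] at e3
    exact e3.symm
  have fMM : finrank K (M ⊓ M' : Submodule K (E × E)) =
      finrank K (L₁ ⊓ L₂ ⊓ L₃ : Submodule K E) := by
    have e : M ⊓ M' = (L₁ ⊓ L₂ ⊓ L₃).map (LinearMap.prod LinearMap.id (-LinearMap.id)) := by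
      ext ⟨a, b⟩
      simp only [M', Submodule.mem_inf, Submodule.mem_prod, hM, Submodule.mem_map]
      constructor
      · rintro ⟨⟨⟨h2, h3⟩, rfl⟩, ⟨h1, -⟩, -, -⟩
        exact ⟨a, ⟨⟨h1, h2⟩, h3⟩, rfl⟩
      · rintro ⟨c, ⟨⟨h1, h2⟩, h3⟩, hc⟩
        obtain ⟨rfl, rfl⟩ := Prod.mk.inj hc
        exact ⟨⟨⟨h2, h3⟩, rfl⟩, ⟨h1, h2⟩, L₁.neg_mem h1, L₃.neg_mem h3⟩
    rw [e]
    exact ((L₁ ⊓ L₂ ⊓ L₃).equivMapOfInjective _ inj_antidiag).finrank_eq.symm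
  have fW : finrank K W = finrank K L₁ + finrank K (L₁ ⊓ L₂ ⊓ L₃ : Submodule K E) := by
    have e1 : W.map (LinearMap.fst K E E) = L₂ ⊓ (L₁ ⊔ L₃) := by
      ext a
      simp only [Submodule.mem_map, LinearMap.fst_apply, Submodule.mem_inf, Submodule.mem_sup]
      constructor
      · rintro ⟨p, hp, rfl⟩
        obtain ⟨⟨h2, h3⟩, h1⟩ := (hW p).1 hp
        exact ⟨h2, _, h1, _, L₃.neg_mem h3, by simp⟩
      · rintro ⟨h2, r, h1, s, h3, rfl⟩
        exact ⟨(r + s, -s), (hW _).2 ⟨⟨h2, L₃.neg_mem h3⟩, by simpa using h1⟩, rfl⟩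
    have e2 : W ⊓ LinearMap.ker (LinearMap.fst K E E) =
        (L₁ ⊓ L₃).map (LinearMap.inr K E E) := by
      ext ⟨a, b⟩
      simp only [Submodule.mem_inf, hW, LinearMap.mem_ker,
        LinearMap.fst_apply, Submodule.mem_map, LinearMap.inr_apply, Prod.mk.injEq]
      constructor
      · rintro ⟨⟨⟨-, hb⟩, hb'⟩, rfl⟩
        exact ⟨b, ⟨by simpa using hb', hb⟩, rfl, rfl⟩
      · rintro ⟨c, hc, rfl, rfl⟩
        exact ⟨⟨⟨L₂.zero_mem, hc.2⟩, by simpa using hc.1⟩, rfl⟩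
    have e3 := Submodule.finrank_map_add_finrank_inf_ker (LinearMap.fst K E E) W
    rw [e1, e2, ← ((L₁ ⊓ L₃).equivMapOfInjective _ inj_inr).finrank_eq] at e3
    have e4 : LinearMap.BilinForm.orthogonal B (L₂ ⊔ (L₁ ⊓ L₃)) = L₂ ⊓ (L₁ ⊔ L₃) := by
      rw [orth_sup, o₂, ← LinearMap.BilinForm.orthogonal_orthogonal hq hr (L₁ ⊔ L₃), orth_sup,
        o₁, o₃]
    have e5 := LinearMap.BilinForm.finrank_orthogonal hq (L₂ ⊔ (L₁ ⊓ L₃))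
    have e6 := Submodule.finrank_sup_add_finrank_inf_eq L₂ (L₁ ⊓ L₃)
    have e7 : L₂ ⊓ (L₁ ⊓ L₃) = L₁ ⊓ L₂ ⊓ L₃ := by rw [← inf_assoc, inf_comm L₂ L₁]
    have e8 := Submodule.finrank_le (L₂ ⊔ (L₁ ⊓ L₃))
    rw [e4] at e5
    rw [e7] at e6
    omega
  have fsum := Submodule.finrank_sup_add_finrank_inf_eq M M'
  rw [hrad] at heven
  rw [Nat.even_iff] at heven ⊢
  omega

end Lagrangians

/-- `t + t⁻¹` in the ring of Laurent polynomials. -/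
noncomputable def traceElt (K : Type*) [Field K] : LaurentPolynomial K :=
  LaurentPolynomial.T 1 + LaurentPolynomial.T (-1)

/-- `t + 1` in the ring of Laurent polynomials. -/
noncomputable def unipElt (K : Type*) [Field K] : LaurentPolynomial K :=
  LaurentPolynomial.T 1 + 1

/-- The quadratic form `Q` on a module over the Laurent polynomials is invariant under `t`. -/
class ShiftInvariant {K V : Type*} [Field K] [AddCommGroup V] [Module K V]
    [Module (LaurentPolynomial K) V] (Q : QuadraticForm K V) : Prop where
  map_shift : ∀ v : V, Q ((LaurentPolynomial.T 1 : LaurentPolynomial K) • v) = Q v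

/-- The polar form of `Q` is nondegenerate on the submodule `X`. -/
def NondegSub {K V : Type*} [Field K] [AddCommGroup V] [Module K V]
    [Module (LaurentPolynomial K) V] (Q : QuadraticForm K V)
    (X : Submodule (LaurentPolynomial K) V) : Prop :=
  ∀ x ∈ X, (∀ y ∈ X, QuadraticMap.polarBilin Q x y = 0) → x = 0

theorem add_self_of_charTwo (K : Type*) {V : Type*} [Field K] [CharP K 2] [AddCommGroup V]
    [Module K V] (v : V) : v + v = 0 := by
  rw [← two_smul K v, CharTwo.two_eq_zero, zero_smul]

theorem eq_of_add_eq_zero_of_charTwo (K : Type*) {V : Type*} [Field K] [CharP K 2]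
    [AddCommGroup V] [Module K V] {v w : V} (hvw : v + w = 0) : v = w := by
  rw [← add_zero v, ← add_self_of_charTwo K w, ← add_assoc, hvw, zero_add]

/-- If the `k`-th power of an irreducible element lies in an ideal, but not the `(k - 1)`-st one,
then it generates the ideal. -/
theorem Irreducible.pow_dvd_of_mem_ideal {K : Type*} [Field K] {p : K[X]} (hp : Irreducible p)
    {I : Ideal K[X]} {k : ℕ} (hk : p ^ (k + 1) ∈ I) (hk' : p ^ k ∉ I) {r : K[X]} (hr : r ∈ I) :
    p ^ (k + 1) ∣ r := by
  obtain ⟨g, hg⟩ := (IsPrincipalIdealRing.principal I).principal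
  have hmem : ∀ x, x ∈ I ↔ g ∣ x := by
    intro x
    rw [hg]; exact Ideal.mem_span_singleton
  rw [hmem] at hk hk' hr
  obtain ⟨i, hi, hgi⟩ := (dvd_prime_pow hp.prime _).1 hk
  have : i = k + 1 := by
    by_contra hne
    exact hk' (hgi.dvd.trans (pow_dvd_pow p (by omega)))
  subst this
  exact hgi.dvd'.trans hr

/-- A linear map that vanishes on the kernel of another one factors through it. -/
theorem LinearMap.exists_comp_eq_of_ker_le {K V V' W : Type*} [Field K] [AddCommGroup V]
    [Module K V] [AddCommGroup V'] [Module K V'] [AddCommGroup W] [Module K W]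
    (f : V →ₗ[K] V') (g : V →ₗ[K] W) (hfg : LinearMap.ker f ≤ LinearMap.ker g) :
    ∃ s : V' →ₗ[K] W, ∀ v, s (f v) = g v := by
  obtain ⟨s, hs⟩ := LinearMap.exists_extend
    (((LinearMap.ker f).liftQ g hfg).comp f.quotKerEquivRange.symm.toLinearMap)
  refine ⟨s, fun v => ?_⟩
  have := LinearMap.congr_fun hs ⟨f v, v, rfl⟩
  have e : f.quotKerEquivRange.symm ⟨f v, v, rfl⟩ = Submodule.Quotient.mk v := by
    rw [LinearEquiv.symm_apply_eq]
    rfl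
  simpa [e] using this

/-- Linear maps with the same kernel have ranges of the same dimension. -/
theorem LinearMap.finrank_range_eq_of_ker_eq {K V V' W : Type*} [Field K] [AddCommGroup V]
    [Module K V] [AddCommGroup V'] [Module K V'] [AddCommGroup W] [Module K W]
    (f : V →ₗ[K] V') (g : V →ₗ[K] W) (hfg : LinearMap.ker f = LinearMap.ker g) :
    finrank K (LinearMap.range f) = finrank K (LinearMap.range g) :=
  (f.quotKerEquivRange.symm.trans
    ((Submodule.quotEquivOfEq _ _ hfg).trans g.quotKerEquivRange)).finrank_eq

/-- `s` is an isometric involution of the submodule `X` that conjugates `t` into its inverse. -/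
structure IsReverser {K V : Type*} [Field K] [AddCommGroup V] [Module K V]
    [Module (LaurentPolynomial K) V] (Q : QuadraticForm K V)
    (X : Submodule (LaurentPolynomial K) V) (s : V →ₗ[K] V) : Prop where
  mem : ∀ x ∈ X, s x ∈ X
  map_form : ∀ x ∈ X, Q (s x) = Q x
  invol : ∀ x ∈ X, s (s x) = x
  rev : ∀ x ∈ X, s ((LaurentPolynomial.T 1 : LaurentPolynomial K) • s
    ((LaurentPolynomial.T 1 : LaurentPolynomial K) • x)) = x

/-- The vectors `x`, `y` are killed by `(t + 1) ^ (e + 1)` and their top layer is a hyperbolic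
pair for the form `(x, y) ↦ f_Q((t + 1) ^ e x, y)`. -/
structure IsBlock {K V : Type*} [Field K] [AddCommGroup V] [Module K V]
    [Module (LaurentPolynomial K) V] (Q : QuadraticForm K V) (e : ℕ) (x y : V) : Prop where
  pow_left : unipElt K ^ (e + 1) • x = 0
  pow_right : unipElt K ^ (e + 1) • y = 0
  polar_ne : QuadraticMap.polarBilin Q (unipElt K ^ e • x) y ≠ 0
  polar_left : QuadraticMap.polarBilin Q (unipElt K ^ e • x) x = 0
  polar_right : QuadraticMap.polarBilin Q (unipElt K ^ e • y) y = 0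

theorem finrank_degreeLT_eq (K : Type*) [Field K] (d : ℕ) :
    finrank K (Polynomial.degreeLT K d) = d := by
  rw [(Polynomial.degreeLTEquiv K d).finrank_eq, finrank_fin_fun]

section Dickson

variable {K E : Type*} [Field K] [AddCommGroup E] [Module K E]

theorem polarBilin_prod_nondegenerate (q : QuadraticForm K E) (hq : q.polarBilin.Nondegenerate) :
    (QuadraticMap.polarBilin (q.prod q)).Nondegenerate := by
  have hsep : (QuadraticMap.polarBilin (q.prod q)).SeparatingLeft := by
    rintro ⟨x, y⟩ h
    have hx : x = 0 := hq.1 x fun z => by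
      have := h (z, 0)
      simpa using this
    have hy : y = 0 := hq.1 y fun z => by
      have := h (0, z)
      simpa using this
    rw [hx, hy]
    rfl
  exact ⟨hsep, fun y h => hsep y fun x => by
    have := h x
    rw [QuadraticMap.polarBilin_apply_apply] at this ⊢
    rwa [QuadraticMap.polar_comm]⟩

/-- The graph of an endomorphism. -/
def graphSub (a : E →ₗ[K] E) : Submodule K (E × E) := LinearMap.range (LinearMap.id.prod a)

theorem finrank_graphSub (a : E →ₗ[K] E) : finrank K (graphSub a) = finrank K E :=
  LinearMap.finrank_range_of_inj fun _ _ h => (Prod.ext_iff.1 h).1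

theorem mem_graphSub {a : E →ₗ[K] E} {p : E × E} : p ∈ graphSub a ↔ a p.1 = p.2 := by
  constructor
  · rintro ⟨x, rfl⟩
    rfl
  · intro h
    exact ⟨p.1, Prod.ext rfl h⟩

theorem finrank_graphSub_inf (a b : E →ₗ[K] E) :
    finrank K (graphSub a ⊓ graphSub b : Submodule K (E × E)) =
      finrank K (LinearMap.ker (a - b)) := by
  have h1 : graphSub a ⊓ graphSub b = (LinearMap.ker (a - b)).map (LinearMap.id.prod a) := by
    ext p
    rw [Submodule.mem_inf, mem_graphSub, mem_graphSub]
    constructor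
    · rintro ⟨h, h'⟩
      refine ⟨p.1, ?_, Prod.ext rfl h⟩
      change (a - b) p.1 = 0
      rw [LinearMap.sub_apply, h, h', sub_self]
    · rintro ⟨x, hx, rfl⟩
      have hx' : (a - b) x = 0 := hx
      rw [LinearMap.sub_apply, sub_eq_zero] at hx'
      exact ⟨rfl, hx'.symm⟩
  rw [h1]
  exact (Submodule.equivMapOfInjective (LinearMap.id.prod a)
    (fun _ _ h => (Prod.ext_iff.1 h).1) _).finrank_eq.symm

theorem graphSub_singular [CharP K 2] {q : QuadraticForm K E} {a : E →ₗ[K] E} (ha : ∀ x, q (a x) = q x) :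
    ∀ p ∈ graphSub a, (q.prod q) p = 0 := by
  intro p hp
  rw [mem_graphSub] at hp
  rw [QuadraticMap.prod_apply, ← hp, ha, CharTwo.add_self_eq_zero]

variable [FiniteDimensional K E] [CharP K 2] (q : QuadraticForm K E)

/-- The Dickson invariant is multiplicative in characteristic two. -/
theorem even_finrank_ker_of_isometry (hq : q.polarBilin.Nondegenerate) {a b : E →ₗ[K] E} (ha : ∀ x, q (a x) = q x)
    (hb : ∀ x, q (b x) = q x) :
    Even (finrank K E + finrank K (LinearMap.ker (a - LinearMap.id)) +
      finrank K (LinearMap.ker (b - LinearMap.id)) + finrank K (LinearMap.ker (a - b))) := by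
  have h := even_finrank_inf_of_singular (q.prod q) (polarBilin_prod_nondegenerate q hq)
    (graphSub_singular (q := q) (a := LinearMap.id) fun _ => rfl) (graphSub_singular ha)
    (graphSub_singular hb) (by rw [finrank_graphSub, Module.finrank_prod, two_mul])
    (by rw [finrank_graphSub, Module.finrank_prod, two_mul])
    (by rw [finrank_graphSub, Module.finrank_prod, two_mul])
  have h1 := inf_comm (graphSub (LinearMap.id : E →ₗ[K] E)) (graphSub a)
  have h2 := inf_comm (graphSub (LinearMap.id : E →ₗ[K] E)) (graphSub b)
  rwa [finrank_graphSub, h1, h2, finrank_graphSub_inf, finrank_graphSub_inf,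
    finrank_graphSub_inf] at h

/-- An isometry stabilizing a Lagrangian has trivial Dickson invariant. -/
theorem even_finrank_ker_of_stable_singular (hq : q.polarBilin.Nondegenerate) {g : E →ₗ[K] E} (hg : ∀ x, q (g x) = q x)
    {S : Submodule K E} (hS : ∀ x ∈ S, q x = 0) (hdS : 2 * finrank K S = finrank K E)
    (hgS : ∀ x ∈ S, g x ∈ S) : Even (finrank K (LinearMap.ker (g - LinearMap.id))) := by
  have hprod : finrank K (S.prod S) = finrank K E := by
    have h1 : LinearMap.range (S.subtype.prodMap S.subtype) = S.prod S := by
      rw [LinearMap.range_prodMap, Submodule.range_subtype]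
    rw [← h1, LinearMap.finrank_range_of_inj, Module.finrank_prod, ← two_mul, hdS]
    exact Function.Injective.prodMap S.injective_subtype S.injective_subtype
  have h := even_finrank_inf_of_singular (q.prod q) (polarBilin_prod_nondegenerate q hq)
    (graphSub_singular (q := q) (a := LinearMap.id) fun _ => rfl) (graphSub_singular hg)
    (L₃ := S.prod S) (fun p hp => by
      rw [QuadraticMap.prod_apply, hS _ hp.1, hS _ hp.2, add_zero])
    (by rw [finrank_graphSub, Module.finrank_prod, two_mul])
    (by rw [finrank_graphSub, Module.finrank_prod, two_mul])
    (by rw [hprod, Module.finrank_prod, two_mul])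
  have hmap : ∀ a : E →ₗ[K] E, (∀ x ∈ S, a x ∈ S) →
      finrank K (graphSub a ⊓ S.prod S : Submodule K (E × E)) = finrank K S := by
    intro a ha
    have h1 : graphSub a ⊓ S.prod S = S.map (LinearMap.id.prod a) := by
      ext p
      rw [Submodule.mem_inf, mem_graphSub]
      constructor
      · rintro ⟨h, h'⟩
        exact ⟨p.1, h'.1, Prod.ext rfl h⟩
      · rintro ⟨x, hx, rfl⟩
        exact ⟨rfl, hx, ha x hx⟩
    rw [h1]
    exact (Submodule.equivMapOfInjective (LinearMap.id.prod a)
    (fun _ _ h => (Prod.ext_iff.1 h).1) _).finrank_eq.symm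
  rw [inf_comm, hmap _ hgS, hmap _ fun x hx => hx, finrank_graphSub, finrank_graphSub_inf] at h
  have : ∀ n s d : ℕ, Even (n + d + s + s) → 2 * s = n → Even d := by
    intro n s d h1 h2
    rw [Nat.even_iff] at *
    omega
  exact this _ _ _ h hdS

end Dickson

section LaurentModules

open LaurentPolynomial (T invert)

variable [Field K]

local notation "𝓡" => LaurentPolynomial K
local notation "𝔱" => (T 1 : LaurentPolynomial K)
local notation "𝔲" => (T (-1) : LaurentPolynomial K)
local notation "𝔥" => traceElt K
local notation "𝔫" => unipElt K
local notation "κ" => (aeval (traceElt K) : K[X] →ₐ[K] LaurentPolynomial K)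

theorem T_one_mul_T_neg_one : 𝔱 * 𝔲 = 1 := by
  rw [← LaurentPolynomial.T_add]; simp

theorem invert_traceElt : invert 𝔥 = 𝔥 := by
  simp [traceElt, add_comm]

theorem invert_invert_apply (a : 𝓡) : invert (invert a) = a :=
  LaurentPolynomial.involutive_invert a

theorem invert_aeval_traceElt (p : K[X]) : invert (κ p) = κ p := by
  have := Polynomial.aeval_algHom_apply (invert (R := K)) 𝔥 p
  rw [← this, invert_traceElt]

theorem T_one_mul_self : 𝔱 * 𝔱 = 𝔱 * 𝔥 - 1 := by
  rw [traceElt, mul_add, T_one_mul_T_neg_one, add_sub_cancel_right]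

theorem T_neg_one_eq : 𝔲 = 𝔥 - 𝔱 := by
  rw [traceElt, add_sub_cancel_left]

theorem exists_eq_aeval_add (a : 𝓡) : ∃ b c : K[X], a = κ b + 𝔱 * κ c := by
  have hmul : ∀ a : 𝓡, (∃ b c : K[X], a = κ b + 𝔱 * κ c) →
      ∃ b c : K[X], 𝔱 * a = κ b + 𝔱 * κ c := by
    rintro a ⟨b, c, rfl⟩
    refine ⟨-c, b + X * c, ?_⟩
    simp only [map_neg, map_add, map_mul, aeval_X]
    linear_combination κ c * T_one_mul_self (K := K)
  have hmul' : ∀ a : 𝓡, (∃ b c : K[X], a = κ b + 𝔱 * κ c) →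
      ∃ b c : K[X], 𝔲 * a = κ b + 𝔱 * κ c := by
    rintro a ⟨b, c, rfl⟩
    refine ⟨X * b + c, -b, ?_⟩
    simp only [map_neg, map_add, map_mul, aeval_X]
    linear_combination κ c * T_one_mul_T_neg_one (K := K) + κ b * T_neg_one_eq (K := K)
  induction a using LaurentPolynomial.induction_on' with
  | add p q hp hq =>
    obtain ⟨b, c, rfl⟩ := hp
    obtain ⟨b', c', rfl⟩ := hq
    exact ⟨b + b', c + c', by simp only [map_add]; ring⟩
  | C_mul_T m α =>
    have base : ∃ b c : K[X], LaurentPolynomial.C α = κ b + 𝔱 * κ c :=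
      ⟨C α, 0, by simp [LaurentPolynomial.algebraMap_apply]⟩
    induction m using Int.induction_on with
    | zero => simpa using base
    | succ i ih =>
      rw [LaurentPolynomial.T_add, ← mul_assoc, mul_comm]
      exact hmul _ ih
    | pred i ih =>
      rw [sub_eq_add_neg, LaurentPolynomial.T_add, ← mul_assoc, mul_comm]
      exact hmul' _ ih

theorem T_one_eq : 𝔱 = 𝔫 - 1 := by rw [unipElt, add_sub_cancel_right]

theorem invert_unipElt : invert 𝔫 = 𝔲 * 𝔫 := by
  simp only [unipElt, map_add, map_one, LaurentPolynomial.invert_T]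
  linear_combination -T_one_mul_T_neg_one (K := K)

section CharTwo

variable [CharP K 2]

instance charP_laurent : CharP 𝓡 2 :=
  charP_of_injective_algebraMap (algebraMap K 𝓡).injective 2

theorem traceElt_eq : 𝔥 = 𝔲 * 𝔫 ^ 2 := by
  have h2 : (2 : 𝓡) = 0 := CharTwo.two_eq_zero
  rw [traceElt, unipElt]
  linear_combination -h2 - (𝔱 + 2) * T_one_mul_T_neg_one (K := K)

end CharTwo

set_option linter.unusedSectionVars false

variable [CharP K 2] [AddCommGroup V] [Module K V] [Module (LaurentPolynomial K) V]
  [IsScalarTower K (LaurentPolynomial K) V]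
  (Q : QuadraticForm K V) [ShiftInvariant Q]

local notation "𝓑" => QuadraticMap.polarBilin Q

local notation "𝓢" => Submodule.restrictScalars K

theorem C_smul_eq (α : K) (v : V) : (LaurentPolynomial.C α : 𝓡) • v = α • v := by
  rw [← algebraMap_smul 𝓡 α v]; rfl

theorem polar_comm' (x y : V) : 𝓑 x y = 𝓑 y x := by
  simp only [QuadraticMap.polarBilin_apply_apply]
  rw [QuadraticMap.polar_comm]

theorem polar_self' (x : V) : 𝓑 x x = 0 := by
  simp only [QuadraticMap.polarBilin_apply_apply]
  rw [QuadraticMap.polar_self, two_smul, CharTwo.add_self_eq_zero]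

theorem map_add_polar (x y : V) : Q (x + y) = Q x + Q y + 𝓑 x y := by
  simp [QuadraticMap.polar]

theorem map_shift (v : V) : Q (𝔱 • v) = Q v := ShiftInvariant.map_shift v

theorem map_shift_inv (v : V) : Q (𝔲 • v) = Q v := by
  rw [← map_shift Q (𝔲 • v), smul_smul, T_one_mul_T_neg_one, one_smul]

theorem polar_shift (x y : V) : 𝓑 (𝔱 • x) (𝔱 • y) = 𝓑 x y := by
  simp [QuadraticMap.polar, ← smul_add, map_shift]

theorem polar_smul (a : 𝓡) (x y : V) : 𝓑 (a • x) y = 𝓑 x (invert a • y) := by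
  have h1 : ∀ x y : V, 𝓑 (𝔱 • x) y = 𝓑 x (𝔲 • y) := by
    intro x y
    rw [← polar_shift Q x, smul_smul, T_one_mul_T_neg_one, one_smul]
  have h2 : ∀ x y : V, 𝓑 (𝔲 • x) y = 𝓑 x (𝔱 • y) := by
    intro x y
    rw [polar_comm', ← h1, polar_comm']
  induction a using LaurentPolynomial.induction_on' with
  | add p q hp hq =>
    rw [add_smul, map_add, LinearMap.add_apply, hp, hq, map_add, add_smul, map_add]
  | C_mul_T m α =>
    simp only [map_mul, LaurentPolynomial.invert_C, LaurentPolynomial.invert_T, mul_smul,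
      C_smul_eq, map_smul, LinearMap.smul_apply]
    congr 1
    induction m using Int.induction_on generalizing x y with
    | zero => simp
    | succ i ih =>
      rw [LaurentPolynomial.T_add, mul_smul, ih, h1, smul_smul, ← LaurentPolynomial.T_add]
      congr 3; ring
    | pred i ih =>
      rw [sub_eq_add_neg, LaurentPolynomial.T_add, mul_smul, ih, h2, smul_smul,
        ← LaurentPolynomial.T_add]
      congr 3; ring

theorem map_T_smul (m : ℤ) (x : V) : Q ((T m : 𝓡) • x) = Q x := by
  induction m using Int.induction_on with
  | zero => simp
  | succ i ih => rw [add_comm, LaurentPolynomial.T_add, mul_smul, map_shift, ih]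
  | pred i ih =>
    rw [sub_eq_add_neg, add_comm, LaurentPolynomial.T_add, mul_smul, map_shift_inv, ih]

theorem map_smul_eq_map_smul {x x' : V} (hQ : Q x' = Q x)
    (hB : ∀ a : 𝓡, 𝓑 (a • x') x' = 𝓑 (a • x) x) (a : 𝓡) : Q (a • x') = Q (a • x) := by
  induction a using LaurentPolynomial.induction_on' with
  | add p q hp hq =>
    have h1 : ∀ z : V, 𝓑 (p • z) (q • z) = 𝓑 ((invert q * p) • z) z := by
      intro z
      rw [mul_smul, polar_smul Q (invert q), invert_invert_apply]
    rw [add_smul, add_smul, map_add_polar, map_add_polar, hp, hq, h1, h1, hB]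
  | C_mul_T m α =>
    rw [mul_smul, mul_smul, C_smul_eq, C_smul_eq, QuadraticMap.map_smul, QuadraticMap.map_smul,
      map_T_smul, map_T_smul, hQ]

theorem polar_invert_smul_self (a : 𝓡) (x : V) : 𝓑 (invert a • x) x = 𝓑 (a • x) x := by
  rw [polar_smul, invert_invert_apply, polar_comm']

theorem map_invert_smul (a : 𝓡) (x : V) : Q (invert a • x) = Q (a • x) := by
  induction a using LaurentPolynomial.induction_on' with
  | add p q hp hq =>
    rw [map_add, add_smul, add_smul, map_add_polar, map_add_polar, hp, hq]
    congr 1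
    rw [polar_smul, invert_invert_apply, smul_smul, polar_comm', polar_smul, map_mul,
      invert_invert_apply, polar_smul Q p, smul_smul]
  | C_mul_T m α =>
    rw [map_mul, LaurentPolynomial.invert_C, LaurentPolynomial.invert_T, mul_smul, mul_smul,
      C_smul_eq, C_smul_eq, QuadraticMap.map_smul, QuadraticMap.map_smul, map_T_smul, map_T_smul]

/-- Elements of `K[t + t⁻¹]` act by self-adjoint operators. -/
theorem polar_aeval_smul (p : K[X]) (x y : V) : 𝓑 (κ p • x) y = 𝓑 x (κ p • y) := by
  rw [polar_smul, invert_aeval_traceElt]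

theorem polar_traceElt_pow_smul (i : ℕ) (x y : V) : 𝓑 (𝔥 ^ i • x) y = 𝓑 x (𝔥 ^ i • y) := by
  rw [polar_smul, map_pow, invert_traceElt]

theorem polar_traceElt_smul_self (x : V) : 𝓑 (𝔥 • x) x = 0 := by
  rw [traceElt_eq, pow_two, ← mul_assoc, mul_comm, mul_smul, polar_smul, invert_unipElt,
    polar_self']

theorem polar_aeval_smul_self (p : K[X]) (x : V) : 𝓑 (κ p • x) x = 0 := by
  induction p using Polynomial.induction_on' with
  | add p q hp hq => rw [map_add, add_smul, map_add, LinearMap.add_apply, hp, hq, add_zero]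
  | monomial i α =>
    rw [← C_mul_X_pow_eq_monomial, map_mul, map_pow, aeval_X, aeval_C, mul_smul, algebraMap_smul,
      map_smul, LinearMap.smul_apply]
    obtain ⟨j, rfl | rfl⟩ := i.even_or_odd'
    · rw [two_mul, pow_add, mul_smul, polar_traceElt_pow_smul, polar_self', smul_zero]
    · rw [pow_succ', two_mul, pow_add, mul_left_comm, mul_smul, polar_traceElt_pow_smul, mul_smul,
        polar_traceElt_smul_self, smul_zero]

theorem polar_unipElt_smul (x y : V) : 𝓑 (𝔫 • x) (𝔫 • y) = 𝓑 (𝔥 • x) y := by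
  rw [polar_smul, invert_unipElt, polar_comm', smul_smul, mul_assoc, ← pow_two, ← traceElt_eq,
    polar_smul, invert_traceElt, polar_comm']

/-- The orthogonal of a submodule. -/
def orthSub (X : Submodule (LaurentPolynomial K) V) : Submodule (LaurentPolynomial K) V where
  carrier := {v | ∀ x ∈ X, 𝓑 x v = 0}
  add_mem' {v w} hv hw x hx := by rw [map_add, hv x hx, hw x hx, add_zero]
  zero_mem' x _ := map_zero _
  smul_mem' a v hv x hx := by
    have := hv (invert a • x) (X.smul_mem _ hx)
    rwa [polar_smul, invert_invert_apply] at this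

variable [FiniteDimensional K V]

/-- Orthogonal projection onto a nondegenerate submodule. -/
theorem NondegSub.exists_representing {X : Submodule 𝓡 V} (hX : NondegSub Q X) :
    ∃ ρ : Dual K V →ₗ[K] V, ∀ ξ, ρ ξ ∈ X ∧ ∀ w ∈ X, 𝓑 (ρ ξ) w = ξ w := by
  let g : 𝓢 X →ₗ[K] Dual K (𝓢 X) :=
    ((𝓢 X).subtype.dualMap).comp ((𝓑).comp (𝓢 X).subtype)
  have hg : ∀ x y : 𝓢 X, g x y = 𝓑 (x : V) (y : V) := fun x y => rfl
  have hinj : Function.Injective g := by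
    rw [← LinearMap.ker_eq_bot, LinearMap.ker_eq_bot']
    intro x hx
    have : (x : V) = 0 := hX x x.2 fun y hy => by
      rw [← hg x ⟨y, hy⟩, hx]; rfl
    exact Subtype.ext this
  let e := LinearMap.linearEquivOfInjective g hinj Subspace.dual_finrank_eq.symm
  refine ⟨(𝓢 X).subtype.comp (e.symm.toLinearMap.comp (𝓢 X).subtype.dualMap), fun ξ => ⟨?_, ?_⟩⟩
  · exact (e.symm ((𝓢 X).subtype.dualMap ξ)).2
  · intro w hw
    have h1 : g (e.symm ((𝓢 X).subtype.dualMap ξ)) = (𝓢 X).subtype.dualMap ξ :=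
      e.apply_symm_apply _
    have h2 := LinearMap.congr_fun h1 ⟨w, hw⟩
    exact h2

theorem NondegSub.exists_polar_eq {X : Submodule 𝓡 V} (hX : NondegSub Q X) (ξ : Dual K V) :
    ∃ y ∈ X, ∀ w ∈ X, 𝓑 y w = ξ w := by
  obtain ⟨ρ, hρ⟩ := hX.exists_representing
  exact ⟨ρ ξ, hρ ξ⟩

theorem NondegSub.exists_projection {X : Submodule 𝓡 V} (hX : NondegSub Q X) :
    ∃ π : V →ₗ[K] V, (∀ v, π v ∈ X) ∧ (∀ v, v - π v ∈ orthSub Q X) ∧ (∀ v ∈ X, π v = v) ∧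
      ∀ v ∈ orthSub Q X, π v = 0 := by
  obtain ⟨ρ, hρ⟩ := hX.exists_representing
  have h2 : ∀ v, ∀ x ∈ X, 𝓑 (ρ (𝓑 v)) x = 𝓑 v x := fun v => (hρ (𝓑 v)).2
  refine ⟨ρ.comp 𝓑, fun v => (hρ _).1, fun v x hx => ?_, fun v hv => ?_, fun v hv => ?_⟩
  · rw [LinearMap.comp_apply, map_sub, polar_comm' Q x (ρ _), h2 v x hx, polar_comm', sub_self]
  · rw [← sub_eq_zero]
    refine hX _ (X.sub_mem (hρ _).1 hv) fun x hx => ?_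
    rw [map_sub, LinearMap.sub_apply, LinearMap.comp_apply, h2 v x hx, sub_self]
  · refine hX _ (hρ _).1 fun x hx => ?_
    rw [LinearMap.comp_apply, h2 v x hx, polar_comm', hv x hx]

/-- A nondegenerate submodule splits off. -/
theorem NondegSub.splitting {X Y : Submodule 𝓡 V} (hX : NondegSub Q X) (hY : NondegSub Q Y)
    (hXY : X ≤ Y) :
    NondegSub Q (Y ⊓ orthSub Q X) ∧ X ⊓ (Y ⊓ orthSub Q X) = ⊥ ∧ X ⊔ (Y ⊓ orthSub Q X) = Y := by
  obtain ⟨π, h1, h2, -, -⟩ := hX.exists_projection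
  have hsup : X ⊔ (Y ⊓ orthSub Q X) = Y := by
    apply le_antisymm (sup_le hXY inf_le_left)
    intro v hv
    exact Submodule.mem_sup.2 ⟨π v, h1 v, v - π v,
      ⟨Y.sub_mem hv (hXY (h1 v)), h2 v⟩, add_sub_cancel _ _⟩
  refine ⟨?_, ?_, hsup⟩
  · rintro v ⟨hv, hv'⟩ hvv
    refine hY v hv fun y hy => ?_
    rw [← hsup] at hy
    obtain ⟨x, hx, z, hz, rfl⟩ := Submodule.mem_sup.1 hy
    rw [map_add, hvv z hz, add_zero, polar_comm', hv' x hx]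
  · rw [eq_bot_iff]
    rintro v ⟨hv, -, hv'⟩
    exact hX v hv fun x hx => by rw [polar_comm']; exact hv' x hx

theorem finrank_add_eq_of_splitting {X Y Z : Submodule 𝓡 V} (hb : X ⊓ Z = ⊥) (hs : X ⊔ Z = Y) :
    finrank K (𝓢 X) + finrank K (𝓢 Z) = finrank K (𝓢 Y) := by
  have := Submodule.finrank_sup_add_finrank_inf_eq (𝓢 X) (𝓢 Z)
  rw [← Submodule.restrictScalars_sup, ← Submodule.restrictScalars_inf, hb, hs,
    Submodule.restrictScalars_bot, finrank_bot, add_zero] at this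
  exact this.symm

theorem NondegSub.even_finrank {X : Submodule 𝓡 V} (hX : NondegSub Q X) :
    Even (finrank K (𝓢 X)) := by
  have := even_finrank_add_finrank_radical 𝓑 (𝓢 X) fun x _ => polar_self' Q x
  have hb : 𝓢 X ⊓ LinearMap.BilinForm.orthogonal 𝓑 (𝓢 X) = ⊥ := by
    rw [eq_bot_iff]
    rintro v ⟨hv, hv'⟩
    exact hX v hv fun x hx => by rw [polar_comm']; exact hv' x hx
  rwa [hb, finrank_bot, add_zero] at this

/-- A `t`-stable subspace is a submodule. -/
theorem exists_restrictScalars_eq (W : Submodule K V) (hW : ∀ w ∈ W, 𝔱 • w ∈ W) :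
    ∃ X : Submodule 𝓡 V, 𝓢 X = W := by
  have hu : ∀ w ∈ W, 𝔲 • w ∈ W := by
    let τ : W →ₗ[K] W := (Algebra.lsmul K K V 𝔱).restrict (p := W) (q := W) hW
    have hinj : Function.Injective τ := by
      intro a b hab
      have h1 : 𝔱 • (a : V) = 𝔱 • (b : V) := congrArg Subtype.val hab
      have h2 := congrArg (fun v => 𝔲 • v) h1
      simp only [smul_smul] at h2
      rw [mul_comm, T_one_mul_T_neg_one, one_smul, one_smul] at h2
      exact Subtype.ext h2
    intro w hw
    obtain ⟨w', hw'⟩ := LinearMap.surjective_of_injective hinj ⟨w, hw⟩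
    have h1 : 𝔱 • (w' : V) = w := congrArg Subtype.val hw'
    rw [← h1, smul_smul, mul_comm, T_one_mul_T_neg_one, one_smul]
    exact w'.2
  refine ⟨{ W with smul_mem' := fun r w hw => ?_ }, rfl⟩
  show r • w ∈ W
  replace hw : w ∈ W := hw
  induction r using LaurentPolynomial.induction_on' with
  | add p q hp hq => rw [add_smul]; exact W.add_mem hp hq
  | C_mul_T m α =>
    rw [mul_smul, C_smul_eq]
    refine W.smul_mem _ ?_
    induction m using Int.induction_on with
    | zero => simpa using hw
    | succ i ih => rw [add_comm, LaurentPolynomial.T_add, mul_smul]; exact hW _ ih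
    | pred i ih =>
      rw [sub_eq_add_neg, add_comm, LaurentPolynomial.T_add, mul_smul]; exact hu _ ih

theorem exists_smul_eq_aeval_unipElt_smul (r : 𝓡) (x : V) :
    ∃ a : K[X], r • x = aeval 𝔫 a • x := by
  let f : K[X] →ₗ[K] V :=
    (LinearMap.toSpanSingleton 𝓡 V x).restrictScalars K ∘ₗ (aeval 𝔫 : K[X] →ₐ[K] 𝓡).toLinearMap
  obtain ⟨X', hX'⟩ := exists_restrictScalars_eq (LinearMap.range f) (by
    rintro _ ⟨a, rfl⟩
    refine ⟨X * a - a, ?_⟩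
    simp only [f, LinearMap.comp_apply, LinearMap.restrictScalars_apply,
      LinearMap.toSpanSingleton_apply, AlgHom.toLinearMap_apply, smul_smul]
    congr 1
    rw [T_one_eq, map_sub, map_mul, aeval_X]
    ring)
  have hmem : ∀ v, v ∈ X' ↔ v ∈ LinearMap.range f := fun v => by rw [← hX']; rfl
  have hx : x ∈ X' := (hmem x).2 ⟨1, by simp [f]⟩
  obtain ⟨a, ha⟩ := (hmem _).1 (X'.smul_mem r hx)
  exact ⟨a, ha.symm⟩

theorem IsReverser.polar {X : Submodule 𝓡 V} {s : V →ₗ[K] V} (hs : IsReverser Q X s) {x y : V}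
    (hx : x ∈ X) (hy : y ∈ X) : 𝓑 (s x) (s y) = 𝓑 x y := by
  have h1 := map_add_polar Q x y
  have h2 := map_add_polar Q (s x) (s y)
  rw [← map_add, hs.map_form _ (X.add_mem hx hy), hs.map_form _ hx, hs.map_form _ hy, h1] at h2
  exact (add_left_cancel h2).symm

/-- Reversers of orthogonal submodules can be glued. -/
theorem IsReverser.glue {X Z : Submodule 𝓡 V} (hX : NondegSub Q X) (hZ : Z ≤ orthSub Q X)
    {s₁ s₂ : V →ₗ[K] V} (h₁ : IsReverser Q X s₁) (h₂ : IsReverser Q Z s₂) :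
    ∃ s : V →ₗ[K] V, IsReverser Q (X ⊔ Z) s ∧ (∀ x ∈ X, s x = s₁ x) ∧ ∀ z ∈ Z, s z = s₂ z := by
  obtain ⟨π, -, -, hπ, hπ'⟩ := hX.exists_projection
  let s : V →ₗ[K] V := s₁ ∘ₗ π + s₂ ∘ₗ (LinearMap.id - π)
  have e₁ : ∀ x ∈ X, s x = s₁ x := by
    intro x hx
    simp [s, hπ x hx]
  have e₂ : ∀ z ∈ Z, s z = s₂ z := by
    intro z hz
    simp [s, hπ' z (hZ hz)]
  have key : ∀ v ∈ X ⊔ Z, ∃ x ∈ X, ∃ z ∈ Z, v = x + z ∧ s v = s₁ x + s₂ z := by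
    intro v hv
    obtain ⟨x, hx, z, hz, rfl⟩ := Submodule.mem_sup.1 hv
    exact ⟨x, hx, z, hz, rfl, by rw [map_add, e₁ x hx, e₂ z hz]⟩
  refine ⟨s, ⟨?_, ?_, ?_, ?_⟩, e₁, e₂⟩
  · intro v hv
    obtain ⟨x, hx, z, hz, rfl, e⟩ := key v hv
    rw [e]
    exact Submodule.add_mem_sup (h₁.mem x hx) (h₂.mem z hz)
  · intro v hv
    obtain ⟨x, hx, z, hz, rfl, e⟩ := key v hv
    rw [e, map_add_polar, map_add_polar, h₁.map_form x hx, h₂.map_form z hz,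
      hZ hz x hx, hZ (h₂.mem z hz) _ (h₁.mem x hx)]
  · intro v hv
    obtain ⟨x, hx, z, hz, rfl, e⟩ := key v hv
    rw [e, map_add, e₁ _ (h₁.mem x hx), e₂ _ (h₂.mem z hz), h₁.invol x hx, h₂.invol z hz]
  · intro v hv
    obtain ⟨x, hx, z, hz, rfl, -⟩ := key v hv
    have hx' := X.smul_mem 𝔱 hx
    have hz' := Z.smul_mem 𝔱 hz
    rw [smul_add, map_add, e₁ _ hx', e₂ _ hz', smul_add, map_add,
      e₁ _ (X.smul_mem _ (h₁.mem _ hx')), e₂ _ (Z.smul_mem _ (h₂.mem _ hz')), h₁.rev x hx,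
      h₂.rev z hz]

theorem finrank_map_glue {X Z : Submodule 𝓡 V} (hb : X ⊓ Z = ⊥) {s s₁ s₂ : V →ₗ[K] V}
    (h₁ : ∀ x ∈ X, s₁ x ∈ X) (h₂ : ∀ z ∈ Z, s₂ z ∈ Z) (e₁ : ∀ x ∈ X, s x = s₁ x)
    (e₂ : ∀ z ∈ Z, s z = s₂ z) :
    finrank K ((𝓢 (X ⊔ Z)).map (s - LinearMap.id)) =
      finrank K ((𝓢 X).map (s₁ - LinearMap.id)) + finrank K ((𝓢 Z).map (s₂ - LinearMap.id)) := by
  have m₁ : (𝓢 X).map (s - LinearMap.id) = (𝓢 X).map (s₁ - LinearMap.id) := by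
    ext v
    simp only [Submodule.mem_map]
    refine exists_congr fun x => and_congr_right fun hx => ?_
    rw [LinearMap.sub_apply, LinearMap.sub_apply, e₁ x hx]
  have m₂ : (𝓢 Z).map (s - LinearMap.id) = (𝓢 Z).map (s₂ - LinearMap.id) := by
    ext v
    simp only [Submodule.mem_map]
    refine exists_congr fun x => and_congr_right fun hx => ?_
    rw [LinearMap.sub_apply, LinearMap.sub_apply, e₂ x hx]
  have l₁ : (𝓢 X).map (s₁ - LinearMap.id) ≤ 𝓢 X := by
    rintro _ ⟨x, hx, rfl⟩
    exact (𝓢 X).sub_mem (h₁ x hx) hx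
  have l₂ : (𝓢 Z).map (s₂ - LinearMap.id) ≤ 𝓢 Z := by
    rintro _ ⟨x, hx, rfl⟩
    exact (𝓢 Z).sub_mem (h₂ x hx) hx
  have h3 : (𝓢 X).map (s₁ - LinearMap.id) ⊓ (𝓢 Z).map (s₂ - LinearMap.id) = ⊥ := by
    rw [eq_bot_iff]
    intro v hv
    have : v ∈ X ⊓ Z := ⟨l₁ hv.1, l₂ hv.2⟩
    rwa [hb] at this
  have := Submodule.finrank_sup_add_finrank_inf_eq ((𝓢 X).map (s₁ - LinearMap.id))
    ((𝓢 Z).map (s₂ - LinearMap.id))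
  rw [h3, finrank_bot, add_zero] at this
  rw [Submodule.restrictScalars_sup, Submodule.map_sup, m₁, m₂, this]

theorem IsReverser.comp_shift {X : Submodule 𝓡 V} {s s' : V →ₗ[K] V} (hs : IsReverser Q X s)
    (hs' : ∀ x, s' x = s (𝔱 • x)) : IsReverser Q X s' := by
  refine ⟨?_, ?_, ?_, ?_⟩
  · intro x hx
    rw [hs']; exact hs.mem _ (X.smul_mem _ hx)
  · intro x hx
    rw [hs', hs.map_form _ (X.smul_mem _ hx), map_shift]
  · intro x hx
    rw [hs', hs', hs.rev x hx]
  · intro x hx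
    have hx2 := X.smul_mem 𝔱 (X.smul_mem 𝔱 hx)
    have e := congrArg s (hs.rev (𝔱 • x) (X.smul_mem _ hx))
    rw [hs.invol _ (X.smul_mem 𝔱 (hs.mem _ hx2))] at e
    rw [hs', hs', e, hs.rev x hx]

/-- Construction of reversers on submodules with two generators. -/
theorem exists_isReverser_of_generators {x y x' y' : V} {p q p' q' : 𝓡}
    (hX : NondegSub Q (Submodule.span 𝓡 {x, y}))
    (hx' : x' = p • x + q • y) (hy' : y' = p' • x + q' • y)
    (hx : invert p • x' + invert q • y' = x) (hy : invert p' • x' + invert q' • y' = y)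
    (hQx : Q x' = Q x) (hQy : Q y' = Q y) (hBx : ∀ a : 𝓡, 𝓑 (a • x') x' = 𝓑 (a • x) x)
    (hBy : ∀ a : 𝓡, 𝓑 (a • y') y' = 𝓑 (a • y) y)
    (hBxy : ∀ a : 𝓡, 𝓑 (a • x') y' = 𝓑 (invert a • x) y) :
    ∃ s : V →ₗ[K] V, IsReverser Q (Submodule.span 𝓡 {x, y}) s ∧
      ∀ a b : 𝓡, s (a • x + b • y) = invert a • x' + invert b • y' := by
  let P : 𝓡 × 𝓡 →ₗ[K] V := (LinearMap.coprod (LinearMap.toSpanSingleton 𝓡 V x)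
    (LinearMap.toSpanSingleton 𝓡 V y)).restrictScalars K
  let J : 𝓡 →ₗ[K] 𝓡 := (invert (R := K)).toLinearMap
  let P' : 𝓡 × 𝓡 →ₗ[K] V := (LinearMap.coprod (LinearMap.toSpanSingleton 𝓡 V x')
    (LinearMap.toSpanSingleton 𝓡 V y')).restrictScalars K ∘ₗ LinearMap.prodMap J J
  have hP : ∀ a b : 𝓡, P (a, b) = a • x + b • y := fun a b => rfl
  have hP' : ∀ a b : 𝓡, P' (a, b) = invert a • x' + invert b • y' := fun a b => rfl
  have hBxy' : ∀ a : 𝓡, 𝓑 (a • y') x' = 𝓑 (invert a • y) x := by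
    intro a
    rw [polar_smul, polar_comm', hBxy, invert_invert_apply, polar_smul, polar_comm']
  have hpair : ∀ a b c d : 𝓡, 𝓑 (P' (a, b)) (P' (c, d)) = 𝓑 (P (a, b)) (P (c, d)) := by
    intro a b c d
    have e1 : ∀ (r s : 𝓡) (v w : V), 𝓑 (invert r • v) (invert s • w) =
        𝓑 ((s * invert r) • v) w := by
      intro r s v w
      rw [mul_smul, polar_smul Q s]
    have e2 : ∀ (r s : 𝓡) (v w : V), 𝓑 (r • v) (s • w) = 𝓑 ((invert s * r) • v) w := by
      intro r s v w
      rw [mul_smul, polar_smul Q (invert s), invert_invert_apply]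
    have e3 : ∀ r s : 𝓡, invert (s * invert r) = invert s * r := by
      intro r s
      rw [map_mul, invert_invert_apply]
    simp only [hP, hP', map_add, LinearMap.add_apply, e1, e2, hBx, hBy, hBxy, hBxy', e3]
    have e4 : ∀ (r s : 𝓡) (v : V), 𝓑 ((s * invert r) • v) v = 𝓑 ((invert s * r) • v) v := by
      intro r s v
      rw [← e3, polar_invert_smul_self]
    rw [e4, e4]
  have hX' : ∀ v ∈ Submodule.span 𝓡 {x, y}, ∃ a b : 𝓡, v = P' (a, b) := by
    intro v hv
    obtain ⟨a, b, rfl⟩ := Submodule.mem_span_pair.1 hv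
    refine ⟨invert a * p + invert b * p', invert a * q + invert b * q', ?_⟩
    rw [hP']
    conv_lhs => rw [← hx, ← hy]
    simp only [map_add, map_mul, invert_invert_apply]
    module
  have hmem : ∀ a b, P' (a, b) ∈ Submodule.span 𝓡 {x, y} := by
    intro a b
    rw [hP', hx', hy']
    refine Submodule.mem_span_pair.2 ⟨invert a * p + invert b * p', invert a * q + invert b * q', ?_⟩
    module
  obtain ⟨s, hs⟩ := LinearMap.exists_comp_eq_of_ker_le P P' (by
    rintro ⟨a, b⟩ hab
    rw [LinearMap.mem_ker] at hab ⊢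
    refine hX _ (hmem a b) fun v hv => ?_
    obtain ⟨c, d, rfl⟩ := hX' v hv
    rw [hpair, hab, map_zero, LinearMap.zero_apply])
  have hs' : ∀ a b : 𝓡, s (a • x + b • y) = invert a • x' + invert b • y' := fun a b => hs (a, b)
  have hss : ∀ a b : 𝓡, s (invert a • x' + invert b • y') = a • x + b • y := by
    intro a b
    have e : invert a • x' + invert b • y' =
        (invert a * p + invert b * p') • x + (invert a * q + invert b * q') • y := by
      rw [hx', hy']; module
    rw [e, hs']
    conv_rhs => rw [← hx, ← hy]
    simp only [map_add, map_mul, invert_invert_apply]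
    module
  refine ⟨s, ⟨?_, ?_, ?_, ?_⟩, hs'⟩
  · intro v hv
    obtain ⟨a, b, rfl⟩ := Submodule.mem_span_pair.1 hv
    rw [hs']; exact hmem a b
  · intro v hv
    obtain ⟨a, b, rfl⟩ := Submodule.mem_span_pair.1 hv
    rw [hs', map_add_polar, map_add_polar, map_smul_eq_map_smul Q hQx hBx,
      map_smul_eq_map_smul Q hQy hBy, map_invert_smul, map_invert_smul]
    congr 1
    have := hpair a 0 0 b
    simpa [hP, hP'] using this
  · intro v hv
    obtain ⟨a, b, rfl⟩ := Submodule.mem_span_pair.1 hv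
    rw [hs', hss]
  · intro v hv
    obtain ⟨a, b, rfl⟩ := Submodule.mem_span_pair.1 hv
    have e : 𝔱 • s (𝔱 • (a • x + b • y)) = invert a • x' + invert b • y' := by
      rw [smul_add, smul_smul, smul_smul, hs', map_mul, map_mul, smul_add, smul_smul, smul_smul,
        ← mul_assoc, ← mul_assoc, LaurentPolynomial.invert_T, T_one_mul_T_neg_one, one_mul, one_mul]
    rw [e, hss]

theorem shift_smul_of_unipElt_smul_eq_zero {w : V} (hw : 𝔫 • w = 0) : 𝔱 • w = w := by
  rw [unipElt, add_smul, one_smul] at hw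
  exact eq_of_add_eq_zero_of_charTwo K hw

theorem T_smul_of_unipElt_smul_eq_zero {w : V} (hw : 𝔫 • w = 0) (i : ℤ) : (T i : 𝓡) • w = w := by
  have h1 := shift_smul_of_unipElt_smul_eq_zero hw
  induction i using Int.induction_on with
  | zero => simp
  | succ i ih => rw [LaurentPolynomial.T_add, mul_smul, h1, ih]
  | pred i ih =>
    rw [sub_eq_add_neg, LaurentPolynomial.T_add, mul_smul]
    conv_lhs => rw [← h1]
    rw [smul_smul 𝔲, mul_comm 𝔲, T_one_mul_T_neg_one, one_smul, ih]

theorem traceElt_pow_eq (j : ℕ) : 𝔥 ^ j = T (-j : ℤ) * 𝔫 ^ (2 * j) := by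
  rw [traceElt_eq, mul_pow, LaurentPolynomial.T_pow, pow_mul]
  simp

theorem unipElt_pow_eq (j : ℕ) : 𝔫 ^ (2 * j) = T (j : ℤ) * 𝔥 ^ j := by
  rw [traceElt_pow_eq, ← mul_assoc, ← LaurentPolynomial.T_add]
  simp

theorem invert_unipElt_pow (j : ℕ) : invert (𝔫 ^ j) = T (-j : ℤ) * 𝔫 ^ j := by
  rw [map_pow, invert_unipElt, mul_pow, LaurentPolynomial.T_pow]
  simp

theorem traceElt_pow_smul_eq {e j : ℕ} (hj : e ≤ 2 * j) {x : V} (hx : 𝔫 ^ e • x = 0) :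
    𝔥 ^ j • x = 0 := by
  obtain ⟨i, hi⟩ := Nat.exists_eq_add_of_le' hj
  rw [traceElt_pow_eq, hi, pow_add, mul_smul, mul_smul, hx, smul_zero, smul_zero]

theorem traceElt_pow_smul_top {j : ℕ} {x : V} (hx : 𝔫 ^ (2 * j + 1) • x = 0) :
    𝔥 ^ j • x = 𝔫 ^ (2 * j) • x := by
  rw [traceElt_pow_eq, mul_smul, T_smul_of_unipElt_smul_eq_zero]
  rwa [smul_smul, ← pow_succ']

theorem unipElt_mul_traceElt_pow_smul_top {j : ℕ} {x : V} (hx : 𝔫 ^ (2 * j + 2) • x = 0) :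
    (𝔫 * 𝔥 ^ j) • x = 𝔫 ^ (2 * j + 1) • x := by
  rw [traceElt_pow_eq, mul_left_comm, mul_smul, ← pow_succ', T_smul_of_unipElt_smul_eq_zero]
  rwa [smul_smul, ← pow_succ']

theorem polar_unipElt_pow_smul_self {j : ℕ} {x : V} (hx : 𝔫 ^ (2 * j + 1) • x = 0) :
    𝓑 (𝔫 ^ (2 * j) • x) x = 0 := by
  rw [← traceElt_pow_smul_top hx]
  have := polar_aeval_smul_self Q (X ^ j) x
  rwa [map_pow, aeval_X] at this

theorem polar_unipElt_pow_comm {e : ℕ} {x : V} (hx : 𝔫 ^ (e + 1) • x = 0) (y : V) :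
    𝓑 (𝔫 ^ e • y) x = 𝓑 (𝔫 ^ e • x) y := by
  rw [polar_smul, invert_unipElt_pow, mul_smul, T_smul_of_unipElt_smul_eq_zero, polar_comm']
  rwa [smul_smul, ← pow_succ']

variable {Q} in
theorem IsBlock.symm {e : ℕ} {x y : V} (hb : IsBlock Q e x y) : IsBlock Q e y x where
  pow_left := hb.pow_right
  pow_right := hb.pow_left
  polar_ne := by rw [polar_unipElt_pow_comm Q hb.pow_left]; exact hb.polar_ne
  polar_left := hb.polar_right
  polar_right := hb.polar_left

variable {Q} in
theorem IsBlock.pow_dvd {e : ℕ} {x y : V} (hb : IsBlock Q e x y) {a b : K[X]}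
    (hab : ∀ w ∈ Submodule.span 𝓡 {x, y}, 𝓑 (aeval 𝔫 a • x + aeval 𝔫 b • y) w = 0) :
    X ^ (e + 1) ∣ a ∧ X ^ (e + 1) ∣ b := by
  suffices ∀ j, j ≤ e + 1 → X ^ j ∣ a ∧ X ^ j ∣ b from this _ le_rfl
  intro j
  induction j with
  | zero => simp
  | succ j ih =>
    intro hj
    obtain ⟨⟨a', ha'⟩, ⟨b', hb'⟩⟩ := ih (by omega)
    have key : ∀ z ∈ Submodule.span 𝓡 {x, y},
        a'.coeff 0 * 𝓑 (𝔫 ^ e • x) z + b'.coeff 0 * 𝓑 (𝔫 ^ e • y) z = 0 := by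
      intro z hz
      have h1 := hab (invert (𝔫 ^ (e - j)) • z) (Submodule.smul_mem _ _ hz)
      have h2 : ∀ (c : K[X]) (w : V), 𝔫 ^ (e + 1) • w = 0 →
          (𝔫 ^ (e - j) * aeval 𝔫 (X ^ j * c)) • w = c.coeff 0 • 𝔫 ^ e • w := by
        intro c w hw
        conv_lhs => rw [← Polynomial.divX_mul_X_add c]
        rw [map_mul, map_pow, aeval_X, ← mul_assoc, ← pow_add, Nat.sub_add_cancel (by omega),
          map_add, map_mul, aeval_X, aeval_C, mul_add, ← mul_assoc, mul_right_comm, ← pow_succ,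
          add_smul, mul_comm, mul_smul, hw, smul_zero, zero_add, mul_comm, mul_smul, algebraMap_smul]
      rw [← polar_smul, smul_add, smul_smul, smul_smul, ha', hb', h2 a' x hb.pow_left,
        h2 b' y hb.pow_right] at h1
      simpa using h1
    have hx := key x (Submodule.subset_span (by simp))
    have hy := key y (Submodule.subset_span (by simp))
    rw [hb.polar_left, mul_zero, zero_add] at hx
    rw [hb.polar_right, mul_zero, add_zero] at hy
    have ea := (mul_eq_zero.1 hy).resolve_right hb.polar_ne
    have eb := (mul_eq_zero.1 hx).resolve_right (hb.symm).polar_ne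
    rw [ha', hb', pow_succ]
    exact ⟨mul_dvd_mul_left _ (Polynomial.X_dvd_iff.2 ea),
      mul_dvd_mul_left _ (Polynomial.X_dvd_iff.2 eb)⟩

theorem aeval_unipElt_smul_eq_zero {e : ℕ} {x : V} (hx : 𝔫 ^ e • x = 0) {a : K[X]}
    (ha : X ^ e ∣ a) : aeval 𝔫 a • x = 0 := by
  obtain ⟨b, rfl⟩ := ha
  rw [mul_comm, map_mul, map_pow, aeval_X, mul_smul, hx, smul_zero]

theorem mem_span_pair_iff_aeval {x y v : V} : v ∈ Submodule.span 𝓡 {x, y} ↔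
    ∃ a b : K[X], aeval 𝔫 a • x + aeval 𝔫 b • y = v := by
  rw [Submodule.mem_span_pair]
  constructor
  · rintro ⟨r, s, rfl⟩
    obtain ⟨a, ha⟩ := exists_smul_eq_aeval_unipElt_smul r x
    obtain ⟨b, hb⟩ := exists_smul_eq_aeval_unipElt_smul s y
    exact ⟨a, b, by rw [ha, hb]⟩
  · rintro ⟨a, b, rfl⟩
    exact ⟨_, _, rfl⟩

variable {Q} in
theorem IsBlock.nondegSub {e : ℕ} {x y : V} (hb : IsBlock Q e x y) :
    NondegSub Q (Submodule.span 𝓡 {x, y}) := by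
  intro v hv hvv
  obtain ⟨a, b, rfl⟩ := mem_span_pair_iff_aeval.1 hv
  obtain ⟨ha, hb'⟩ := hb.pow_dvd hvv
  rw [aeval_unipElt_smul_eq_zero hb.pow_left ha, aeval_unipElt_smul_eq_zero hb.pow_right hb',
    add_zero]

variable {Q} in
theorem IsBlock.disjoint {e : ℕ} {x y : V} (hb : IsBlock Q e x y) :
    Submodule.span 𝓡 {x} ⊓ Submodule.span 𝓡 {y} = ⊥ := by
  rw [eq_bot_iff]
  rintro v ⟨hv, hv'⟩
  obtain ⟨r, rfl⟩ := Submodule.mem_span_singleton.1 hv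
  obtain ⟨s, hs⟩ := Submodule.mem_span_singleton.1 hv'
  obtain ⟨a, ha⟩ := exists_smul_eq_aeval_unipElt_smul r x
  obtain ⟨b, hb'⟩ := exists_smul_eq_aeval_unipElt_smul s y
  have h0 : aeval 𝔫 a • x + aeval 𝔫 b • y = 0 := by
    rw [← ha, ← hb', hs, add_self_of_charTwo K]
  have := hb.pow_dvd (a := a) (b := b) fun w _ => by rw [h0, map_zero, LinearMap.zero_apply]
  rw [ha, aeval_unipElt_smul_eq_zero hb.pow_left this.1]
  exact Submodule.zero_mem _

theorem aeval_modByMonic_unipElt {e : ℕ} {x : V} (hx : 𝔫 ^ e • x = 0) (a : K[X]) :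
    aeval 𝔫 (a %ₘ X ^ e) • x = aeval 𝔫 a • x := by
  conv_rhs => rw [← Polynomial.modByMonic_add_div a (X ^ e)]
  rw [map_add, add_smul, aeval_unipElt_smul_eq_zero hx (dvd_mul_right _ _), add_zero]

theorem modByMonic_mem_degreeLT (e : ℕ) (a : K[X]) : a %ₘ X ^ e ∈ Polynomial.degreeLT K e := by
  rw [Polynomial.mem_degreeLT]
  have := Polynomial.degree_modByMonic_lt a (Polynomial.monic_X_pow (R := K) e)
  rwa [Polynomial.degree_X_pow] at this

variable {Q} in
theorem IsBlock.finrank_eq {e : ℕ} {x y : V} (hb : IsBlock Q e x y) :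
    finrank K (𝓢 (Submodule.span 𝓡 {x, y})) = 2 * (e + 1) := by
  let ρ : V → K[X] →ₗ[K] V := fun z =>
    (LinearMap.toSpanSingleton 𝓡 V z).restrictScalars K ∘ₗ (aeval 𝔫 : K[X] →ₐ[K] 𝓡).toLinearMap
  let f : (Polynomial.degreeLT K (e + 1) × Polynomial.degreeLT K (e + 1)) →ₗ[K] V :=
    LinearMap.coprod ((ρ x).comp (Submodule.subtype _)) ((ρ y).comp (Submodule.subtype _))
  have hf : ∀ a b, f (a, b) = aeval 𝔫 (a : K[X]) • x + aeval 𝔫 (b : K[X]) • y := fun a b => rfl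
  have hdeg : ∀ a : Polynomial.degreeLT K (e + 1), X ^ (e + 1) ∣ (a : K[X]) → a = 0 := by
    intro a ha
    apply Subtype.ext
    refine Polynomial.eq_zero_of_dvd_of_degree_lt ha ?_
    rw [Polynomial.degree_X_pow]
    exact Polynomial.mem_degreeLT.1 a.2
  have hinj : Function.Injective f := by
    rw [← LinearMap.ker_eq_bot, LinearMap.ker_eq_bot']
    rintro ⟨a, b⟩ hab
    rw [hf] at hab
    obtain ⟨h1, h2⟩ := hb.pow_dvd (a := a) (b := b) fun w _ => by
      rw [hab, map_zero, LinearMap.zero_apply]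
    rw [hdeg a h1, hdeg b h2]
    rfl
  have hrange : LinearMap.range f = 𝓢 (Submodule.span 𝓡 {x, y}) := by
    ext v
    rw [Submodule.restrictScalars_mem, mem_span_pair_iff_aeval]
    constructor
    · rintro ⟨⟨a, b⟩, rfl⟩
      exact ⟨a, b, rfl⟩
    · rintro ⟨a, b, rfl⟩
      refine ⟨(⟨_, modByMonic_mem_degreeLT (e + 1) a⟩, ⟨_, modByMonic_mem_degreeLT (e + 1) b⟩), ?_⟩
      rw [hf, aeval_modByMonic_unipElt hb.pow_left, aeval_modByMonic_unipElt hb.pow_right]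
  rw [← hrange, LinearMap.finrank_range_of_inj hinj, Module.finrank_prod, finrank_degreeLT_eq]
  ring

theorem finrank_span_singleton_le {e : ℕ} {x : V} (hx : 𝔫 ^ e • x = 0) :
    finrank K (𝓢 (Submodule.span 𝓡 {x})) ≤ e := by
  let ρ : Polynomial.degreeLT K e →ₗ[K] V :=
    ((LinearMap.toSpanSingleton 𝓡 V x).restrictScalars K ∘ₗ
      (aeval 𝔫 : K[X] →ₐ[K] 𝓡).toLinearMap).comp (Submodule.subtype _)
  have hrange : 𝓢 (Submodule.span 𝓡 {x}) ≤ LinearMap.range ρ := by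
    intro v hv
    obtain ⟨r, rfl⟩ := Submodule.mem_span_singleton.1 hv
    obtain ⟨a, ha⟩ := exists_smul_eq_aeval_unipElt_smul r x
    refine ⟨⟨_, modByMonic_mem_degreeLT e a⟩, ?_⟩
    rw [ha, ← aeval_modByMonic_unipElt hx]
    rfl
  have : FiniteDimensional K (Polynomial.degreeLT K e) :=
    (Polynomial.degreeLTEquiv K e).symm.finiteDimensional
  calc _ ≤ finrank K (LinearMap.range ρ) := Submodule.finrank_mono hrange
    _ ≤ finrank K (Polynomial.degreeLT K e) := LinearMap.finrank_range_le ρ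
    _ = e := finrank_degreeLT_eq K e

/-- A cyclic submodule generated by a vector `y` killed by the `(k + 1)`-st power of an irreducible
polynomial in `t + t⁻¹` is nondegenerate as soon as its top layer is. -/
theorem nondegSub_span_singleton {p : K[X]} (hp : Irreducible p) {k : ℕ} {y : V}
    (hy : κ (p ^ (k + 1)) • y = 0) (hy' : 𝓑 ((𝔱 * κ (p ^ k)) • y) y ≠ 0) :
    NondegSub Q (Submodule.span 𝓡 {y}) := by
  let I : Ideal K[X] :=
    { carrier := {r | ∀ d : K[X], 𝓑 ((𝔱 * κ (r * d)) • y) y = 0}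
      add_mem' := fun {r s} hr hs d => by
        rw [add_mul, map_add, mul_add, add_smul, map_add, LinearMap.add_apply, hr, hs, add_zero]
      zero_mem' := fun d => by simp
      smul_mem' := fun c r hr d => by
        rw [smul_eq_mul, mul_comm c, mul_assoc]; exact hr _ }
  have hI : ∀ r, r ∈ I ↔ ∀ d : K[X], 𝓑 ((𝔱 * κ (r * d)) • y) y = 0 := fun r => Iff.rfl
  have h1 : p ^ (k + 1) ∈ I := by
    intro d
    rw [mul_comm (p ^ (k + 1)), map_mul, ← mul_assoc, mul_smul, hy, smul_zero, map_zero,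
      LinearMap.zero_apply]
  have h2 : p ^ k ∉ I := by
    intro hmem
    have := hmem 1
    rw [mul_one] at this
    exact hy' this
  have hzero : ∀ r ∈ I, κ r • y = 0 := by
    intro r hr
    obtain ⟨c, rfl⟩ := hp.pow_dvd_of_mem_ideal h1 h2 hr
    rw [mul_comm, map_mul, mul_smul, hy, smul_zero]
  intro v hv hvv
  obtain ⟨r, rfl⟩ := Submodule.mem_span_singleton.1 hv
  obtain ⟨b, c, rfl⟩ := exists_eq_aeval_add r
  have hpair : ∀ a : 𝓡, 𝓑 ((κ b + 𝔱 * κ c) • y) (a • y) = 0 := fun a =>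
    hvv _ (Submodule.smul_mem _ _ (Submodule.mem_span_singleton_self y))
  have hc : κ c • y = 0 := by
    refine hzero c fun d => ?_
    have := hpair (κ d)
    rw [← polar_aeval_smul, smul_smul, mul_add, add_smul, map_add, LinearMap.add_apply,
      ← map_mul, polar_aeval_smul_self, zero_add, mul_left_comm, ← map_mul, mul_comm d] at this
    exact this
  have hb : κ b • y = 0 := by
    refine hzero b fun d => ?_
    have := hpair (𝔱 * κ d)
    rw [add_smul, mul_smul 𝔱 (κ c), hc, smul_zero, add_zero, polar_aeval_smul, polar_comm',
      smul_smul, mul_left_comm, ← map_mul] at this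
    exact this
  rw [add_smul, mul_smul, hb, hc, smul_zero, add_zero]

theorem polar_shift_traceElt_pow {j : ℕ} {x : V} (hx : 𝔫 ^ (2 * j + 2) • x = 0) :
    𝓑 ((𝔱 * 𝔥 ^ j) • x) x = 𝓑 (𝔫 ^ (2 * j + 1) • x) x := by
  rw [← unipElt_mul_traceElt_pow_smul_top hx, unipElt, add_mul, one_mul, add_smul, map_add,
    LinearMap.add_apply]
  have := polar_aeval_smul_self Q (X ^ j) x
  rw [map_pow, aeval_X] at this
  rw [this, add_zero]

/-- Unipotent case of `nondegSub_span_singleton`. -/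
theorem nondegSub_span_singleton_of_unip {j : ℕ} {x : V} (hx : 𝔫 ^ (2 * j + 2) • x = 0)
    (hx' : 𝓑 (𝔫 ^ (2 * j + 1) • x) x ≠ 0) : NondegSub Q (Submodule.span 𝓡 {x}) := by
  refine nondegSub_span_singleton Q Polynomial.irreducible_X (k := j) ?_ ?_
  · rw [map_pow, aeval_X]
    exact traceElt_pow_smul_eq (e := 2 * j + 2) (by omega) hx
  · rw [map_pow, aeval_X, polar_shift_traceElt_pow Q hx]
    exact hx'

variable {Q} in
theorem exists_isReverser_span_singleton {y : V} (hy : NondegSub Q (Submodule.span 𝓡 {y})) :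
    ∃ s : V →ₗ[K] V, IsReverser Q (Submodule.span 𝓡 {y}) s := by
  have hspan : Submodule.span 𝓡 {y, (0 : V)} = Submodule.span 𝓡 {y} := by
    rw [Submodule.span_insert, Submodule.span_zero_singleton, sup_bot_eq]
  rw [← hspan] at hy ⊢
  obtain ⟨s, hs, -⟩ := exists_isReverser_of_generators Q (x' := y) (y' := 0) (p := 1) (q := 0)
    (p' := 0) (q' := 1) hy (by simp) (by simp) (by simp) (by simp) rfl rfl (fun _ => rfl)
    (fun _ => rfl) (by simp)
  exact ⟨s, hs⟩

variable (K V) in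
theorem exists_aeval_traceElt_smul_eq_zero : ∃ r : K[X], r ≠ 0 ∧ ∀ v : V, κ r • v = 0 := by
  let Λ : 𝓡 →ₐ[K] Module.End K V := Algebra.lsmul K K V
  refine ⟨minpoly K (Λ 𝔥), minpoly.ne_zero (Algebra.IsIntegral.isIntegral _), fun v => ?_⟩
  have h1 := minpoly.aeval K (Λ 𝔥)
  rw [Polynomial.aeval_algHom_apply] at h1
  exact LinearMap.congr_fun h1 v

variable {Q} in
theorem NondegSub.exists_span_singleton_of_not_unip {W : Submodule 𝓡 V} (hW : NondegSub Q W)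
    (hn : ¬ ∃ m, ∀ x ∈ W, 𝔫 ^ m • x = 0) :
    ∃ y ∈ W, y ≠ 0 ∧ NondegSub Q (Submodule.span 𝓡 {y}) := by
  let J : Ideal K[X] :=
    { carrier := {r | ∀ x ∈ W, κ r • x = 0}
      add_mem' := fun {r s} hr hs x hx => by rw [map_add, add_smul, hr x hx, hs x hx, add_zero]
      zero_mem' := fun x _ => by simp
      smul_mem' := fun c r hr x hx => by
        rw [smul_eq_mul, map_mul, mul_smul, hr x hx, smul_zero] }
  obtain ⟨g, hg⟩ := (IsPrincipalIdealRing.principal J).principal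
  have hJ : ∀ r, (∀ x ∈ W, κ r • x = 0) ↔ g ∣ r := fun r => by
    rw [← Ideal.mem_span_singleton]; exact (SetLike.ext_iff.1 hg r)
  have hg0 : g ≠ 0 := by
    obtain ⟨r, hr, hr'⟩ := exists_aeval_traceElt_smul_eq_zero K V
    rintro rfl
    exact hr (zero_dvd_iff.1 ((hJ r).1 fun x _ => hr' x))
  obtain ⟨j, g', hXg', hgg'⟩ := WfDvdMonoid.max_power_factor hg0 (Polynomial.irreducible_X (R := K))
  have hg'0 : g' ≠ 0 := by rintro rfl; exact hXg' (dvd_zero _)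
  by_cases hu : IsUnit g'
  · refine absurd ⟨2 * j, fun x hx => ?_⟩ hn
    have h1 := (hJ (X ^ j)).2 (by rw [hgg']; exact hu.mul_right_dvd.2 dvd_rfl) x hx
    rw [map_pow, aeval_X] at h1
    rw [unipElt_pow_eq, mul_smul, h1, smul_zero]
  obtain ⟨p, hp, hpg'⟩ := WfDvdMonoid.exists_irreducible_factor hu hg'0
  have hpX : ¬ p ∣ X := fun hd =>
    hXg' ((hp.associated_of_dvd Polynomial.irreducible_X hd).symm.dvd.trans hpg')
  obtain ⟨n, q, hpq, hgq⟩ := WfDvdMonoid.max_power_factor hg0 hp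
  have hq0 : q ≠ 0 := by rintro rfl; exact hpq (dvd_zero _)
  obtain ⟨k, rfl⟩ : ∃ k, n = k + 1 := by
    refine Nat.exists_eq_succ_of_ne_zero ?_
    rintro rfl
    rw [pow_zero, one_mul] at hgq
    exact hpq (hgq ▸ hpg'.trans (hgg' ▸ dvd_mul_left _ _))
  set r := p ^ k * q * q with hr
  have hrX : ¬ g ∣ X * r := by
    intro hd
    have : (p ^ k * q) * p ∣ (p ^ k * q) * (X * q) := by
      rw [hgq] at hd
      convert hd using 1 <;> ring
    rw [mul_dvd_mul_iff_left (mul_ne_zero (pow_ne_zero _ hp.ne_zero) hq0)] at this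
    exact (hp.prime.dvd_or_dvd this).elim hpX hpq
  rw [← hJ] at hrX
  push Not at hrX
  obtain ⟨w, hw, hw0⟩ := hrX
  obtain ⟨w', hw', hww'⟩ : ∃ w' ∈ W, 𝓑 (κ (X * r) • w) w' ≠ 0 := by
    by_contra! hcon
    exact hw0 (hW _ (Submodule.smul_mem _ _ hw) hcon)
  have hsum : 𝓑 (κ (X * r) • w) w' = 𝓑 ((𝔱 * κ r) • w) w' + 𝓑 ((𝔱 * κ r) • w') w := by
    rw [map_mul, aeval_X, show 𝔥 * κ r = 𝔱 * κ r + 𝔲 * κ r from add_mul _ _ _, add_smul, map_add, LinearMap.add_apply]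
    congr 1
    rw [polar_smul, polar_comm', map_mul, invert_aeval_traceElt, LaurentPolynomial.invert_T, neg_neg]
  obtain ⟨v, hv, hvv⟩ : ∃ v ∈ W, 𝓑 ((𝔱 * κ r) • v) v ≠ 0 := by
    by_contra! hcon
    have h1 := hcon (w + w') (W.add_mem hw hw')
    rw [smul_add, map_add, map_add, LinearMap.add_apply, LinearMap.add_apply, hcon w hw,
      hcon w' hw', zero_add, add_zero, add_comm] at h1
    exact hww' (hsum.trans h1)
  have hpol : 𝓑 ((𝔱 * κ (p ^ k)) • κ q • v) (κ q • v) ≠ 0 := by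
    rw [← polar_aeval_smul, smul_smul, smul_smul]
    convert hvv using 4
    rw [hr, map_mul, map_mul]
    ring
  refine ⟨κ q • v, W.smul_mem _ hv, ?_, nondegSub_span_singleton Q hp (k := k) ?_ hpol⟩
  · intro h0
    rw [h0] at hpol
    simp at hpol
  · rw [smul_smul, ← map_mul, ← hgq]
    exact (hJ g).2 dvd_rfl v hv

theorem aeval_traceElt_smul_eq_zero_iff {k : ℕ} {x : V} (hx : 𝔥 ^ (k + 1) • x = 0)
    (hx' : 𝔥 ^ k • x ≠ 0) {r : K[X]} : κ r • x = 0 ↔ X ^ (k + 1) ∣ r := by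
  constructor
  · let I : Ideal K[X] :=
      { carrier := {r | κ r • x = 0}
        add_mem' := fun {r s} (hr : _ = _) (hs : _ = _) => by
          rw [Set.mem_ofPred_eq, map_add, add_smul, hr, hs, add_zero]
        zero_mem' := by simp
        smul_mem' := fun c r (hr : _ = _) => by
          rw [Set.mem_ofPred_eq, smul_eq_mul, map_mul, mul_smul, hr, smul_zero] }
    intro hr
    refine Polynomial.irreducible_X.pow_dvd_of_mem_ideal (I := I) (k := k) ?_ ?_ hr
    · change κ _ • x = 0
      rwa [map_pow, aeval_X]
    · change ¬ κ _ • x = 0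
      rwa [map_pow, aeval_X]
  · rintro ⟨c, rfl⟩
    rw [mul_comm, map_mul, mul_smul, map_pow, aeval_X, hx, smul_zero]

theorem aeval_traceElt_pow_mul_smul {k : ℕ} {x : V} (hx : 𝔥 ^ (k + 1) • x = 0) (d : K[X]) :
    κ (X ^ k * d) • x = d.coeff 0 • 𝔥 ^ k • x := by
  conv_lhs => rw [← Polynomial.divX_mul_X_add d]
  rw [mul_add, mul_left_comm, ← pow_succ, map_add, map_mul, add_smul, mul_smul, map_pow, aeval_X,
    hx, smul_zero, zero_add, map_mul, aeval_C, map_pow, aeval_X, mul_comm, mul_smul, algebraMap_smul]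

variable {Q} in
theorem NondegSub.exists_polar_eq_zero_and_ne {X : Submodule 𝓡 V} (hX : NondegSub Q X)
    {P : Submodule K V} (hP : P ≤ 𝓢 X) {v : V} (hv : v ∈ X) (hvP : v ∉ P) :
    ∃ y ∈ X, (∀ w ∈ P, 𝓑 w y = 0) ∧ 𝓑 v y ≠ 0 := by
  obtain ⟨ξ, hξ, hξP⟩ := Submodule.exists_le_ker_of_notMem hvP
  obtain ⟨y, hy, hyX⟩ := hX.exists_polar_eq Q ξ
  refine ⟨y, hy, fun w hw => ?_, ?_⟩
  · rw [polar_comm', hyX w (hP hw)]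
    exact hξP hw
  · rwa [polar_comm', hyX v hv]

/-- The linear map `c ↦ a c(t + t⁻¹) x`. -/
noncomputable def evalTrace (a : 𝓡) (x : V) : K[X] →ₗ[K] V :=
  (LinearMap.toSpanSingleton 𝓡 V (a • x)).restrictScalars K ∘ₗ AlgHom.toLinearMap κ

theorem evalTrace_apply (a : 𝓡) (x : V) (c : K[X]) : evalTrace a x c = (a * κ c) • x := by
  rw [mul_comm, mul_smul]
  rfl

theorem range_evalTrace_le {a : 𝓡} {x : V} {X : Submodule 𝓡 V} (hx : x ∈ X) :
    LinearMap.range (evalTrace a x) ≤ 𝓢 X := by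
  rintro _ ⟨c, rfl⟩
  rw [evalTrace_apply]
  exact X.smul_mem _ hx

variable {Q} in
theorem isBlock_of_odd {k : ℕ} {X : Submodule 𝓡 V} (hX : ∀ x ∈ X, 𝔫 ^ (2 * k + 2) • x = 0)
    (hself : ∀ x ∈ X, 𝓑 (𝔫 ^ (2 * k + 1) • x) x = 0) {x y : V} (hx : x ∈ X) (hy : y ∈ X)
    (hxy : 𝓑 (𝔫 ^ (2 * k + 1) • x) y ≠ 0) : IsBlock Q (2 * k + 1) x y :=
  ⟨hX x hx, hX y hy, hxy, hself x hx, hself y hy⟩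

variable {Q} in
theorem isBlock_of_even {k : ℕ} {X : Submodule 𝓡 V} (hX : ∀ x ∈ X, 𝔫 ^ (2 * k + 1) • x = 0)
    {x y : V} (hx : x ∈ X) (hy : y ∈ X) (hxy : 𝓑 (𝔥 ^ k • x) y ≠ 0) :
    IsBlock Q (2 * k) x y where
  pow_left := hX x hx
  pow_right := hX y hy
  polar_ne := by rwa [← traceElt_pow_smul_top (hX x hx)]
  polar_left := polar_unipElt_pow_smul_self Q (hX x hx)
  polar_right := polar_unipElt_pow_smul_self Q (hX y hy)

theorem unipElt_smul_traceElt_eq (c : K[X]) (x : V) :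
    κ (X * c) • x = (𝔲 * 𝔫) • (𝔫 * κ c) • x := by
  rw [map_mul, aeval_X, traceElt_eq, smul_smul]
  congr 1
  ring

variable {Q} in
theorem exists_isBlock_isReverser_of_odd {k : ℕ} {W : Submodule 𝓡 V} (hW : NondegSub Q W)
    (hN : ∀ x ∈ W, 𝔫 ^ (2 * k + 2) • x = 0) (hself : ∀ x ∈ W, 𝓑 (𝔫 ^ (2 * k + 1) • x) x = 0)
    {x : V} (hx : x ∈ W) (hx0 : 𝔫 ^ (2 * k + 1) • x ≠ 0) :
    ∃ y ∈ W, IsBlock Q (2 * k + 1) x y ∧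
      ∃ s : V →ₗ[K] V, IsReverser Q (Submodule.span 𝓡 {x, y}) s := by
  have hk1 : 𝔥 ^ (k + 1) • x = 0 := traceElt_pow_smul_eq (e := 2 * k + 2) (by omega) (hN x hx)
  have hk0 : 𝔥 ^ k • x ≠ 0 := by
    intro h0
    rw [← unipElt_mul_traceElt_pow_smul_top (hN x hx), mul_smul, h0, smul_zero] at hx0
    exact hx0 rfl
  have hP : 𝔫 ^ (2 * k + 1) • x ∉ LinearMap.range (evalTrace (1 : 𝓡) x) := by
    rintro ⟨c, hc⟩
    rw [evalTrace_apply, one_mul] at hc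
    have h1 : (𝔫 * κ c) • x = 0 := by
      rw [mul_smul, hc, smul_smul, ← pow_succ', hN x hx]
    have h2 : κ (X * c) • x = 0 := by rw [unipElt_smul_traceElt_eq, h1, smul_zero]
    rw [aeval_traceElt_smul_eq_zero_iff hk1 hk0, pow_succ', mul_dvd_mul_iff_left X_ne_zero] at h2
    obtain ⟨d, rfl⟩ := h2
    rw [aeval_traceElt_pow_mul_smul hk1] at hc
    rw [mul_smul, aeval_traceElt_pow_mul_smul hk1, smul_comm, smul_smul,
      unipElt_mul_traceElt_pow_smul_top (hN x hx), smul_eq_zero_iff_left hx0] at h1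
    rw [h1, zero_smul] at hc
    exact hx0 hc.symm
  obtain ⟨y, hy, hPy, hxy⟩ := hW.exists_polar_eq_zero_and_ne (range_evalTrace_le hx)
    (W.smul_mem _ hx) hP
  have hb := isBlock_of_odd hN hself hx hy hxy
  have hPy' : ∀ c, 𝓑 (κ c • x) y = 0 := fun c =>
    hPy _ ⟨c, by rw [evalTrace_apply, one_mul]⟩
  refine ⟨y, hy, hb, ?_⟩
  obtain ⟨s, hs, -⟩ := exists_isReverser_of_generators Q (x' := x) (y' := y) (p := 1) (q := 0)
    (p' := 0) (q' := 1) hb.nondegSub (by simp) (by simp) (by simp) (by simp) rfl rfl (fun _ => rfl)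
    (fun _ => rfl) fun a => by
      obtain ⟨b, c, rfl⟩ := exists_eq_aeval_add a
      apply eq_of_add_eq_zero_of_charTwo K
      rw [map_add, map_mul, invert_aeval_traceElt, invert_aeval_traceElt,
        LaurentPolynomial.invert_T, ← LinearMap.add_apply, ← map_add, ← add_smul]
      convert hPy' (X * c) using 3
      rw [add_add_add_comm, ← two_mul (κ b), CharTwo.two_eq_zero, zero_mul, zero_add, ← add_mul,
        map_mul, aeval_X, traceElt]
  exact ⟨s, hs⟩

variable {Q} in
theorem exists_isBlock_isReverser_even_rank {k : ℕ} {W : Submodule 𝓡 V} (hW : NondegSub Q W)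
    (hN : ∀ x ∈ W, 𝔫 ^ (2 * k + 1) • x = 0) {x : V} (hx : x ∈ W)
    (hx0 : 𝔫 ^ (2 * k) • x ≠ 0) :
    ∃ y ∈ W, IsBlock Q (2 * k) x y ∧
      ∃ s : V →ₗ[K] V, IsReverser Q (Submodule.span 𝓡 {x, y}) s ∧
        Even (finrank K ((𝓢 (Submodule.span 𝓡 {x, y})).map (s - LinearMap.id))) := by
  have hkz : ∀ z ∈ W, 𝔥 ^ (k + 1) • z = 0 := fun z hz =>
    traceElt_pow_smul_eq (e := 2 * k + 1) (by omega) (hN z hz)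
  have hk0 : 𝔥 ^ k • x ≠ 0 := by rwa [traceElt_pow_smul_top (hN x hx)]
  have hNtop : ∀ z ∈ W, 𝔫 • 𝔥 ^ k • z = 0 := fun z hz => by
    rw [traceElt_pow_smul_top (hN z hz), smul_smul, ← pow_succ', hN z hz]
  have key : ∀ z ∈ W, 𝔥 ^ k • z ≠ 0 → ∀ c : K[X],
      (κ (X * c) • z = 0 ↔ X ^ k ∣ c) ∧ ((𝔫 * κ c) • z = 0 ↔ X ^ k ∣ c) := by
    intro z hz hz0 c
    have h1 : κ (X * c) • z = 0 ↔ X ^ k ∣ c := by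
      rw [aeval_traceElt_smul_eq_zero_iff (hkz z hz) hz0, pow_succ',
        mul_dvd_mul_iff_left X_ne_zero]
    refine ⟨h1, fun h2 => h1.1 (by rw [unipElt_smul_traceElt_eq, h2, smul_zero]), ?_⟩
    rintro ⟨d, rfl⟩
    rw [mul_smul, aeval_traceElt_pow_mul_smul (hkz z hz), smul_comm, hNtop z hz, smul_zero]
  have hP : 𝔥 ^ k • x ∉ LinearMap.range (evalTrace (invert 𝔫) x) := by
    rintro ⟨c, hc⟩
    rw [evalTrace_apply, invert_unipElt] at hc
    have h1 : κ (X * c) • x = 0 := by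
      rw [← hNtop x hx, ← hc, unipElt_smul_traceElt_eq, smul_smul, smul_smul]
      congr 1
      ring
    have h2 := ((key x hx hk0 c).2).2 ((key x hx hk0 c).1.1 h1)
    rw [mul_assoc, mul_smul, h2, smul_zero] at hc
    exact hk0 hc.symm
  obtain ⟨y, hy, hPy, hxy⟩ := hW.exists_polar_eq_zero_and_ne (range_evalTrace_le hx)
    (W.smul_mem _ hx) hP
  have hb := isBlock_of_even hN hx hy hxy
  have hPy' : ∀ c, 𝓑 ((invert 𝔫 * κ c) • x) y = 0 := fun c =>
    hPy _ ⟨c, by rw [evalTrace_apply]⟩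
  refine ⟨y, hy, hb, ?_⟩
  have hu : invert 𝔱 = 𝔲 := LaurentPolynomial.invert_T 1
  obtain ⟨s, hs, hsab⟩ := exists_isReverser_of_generators Q (x' := x) (y' := 𝔱 • y) (p := 1)
    (q := 0) (p' := 0) (q' := 𝔱) hb.nondegSub (by simp) (by simp) (by simp)
    (by rw [map_zero, zero_smul, zero_add, smul_smul, hu, mul_comm, T_one_mul_T_neg_one, one_smul])
    rfl (map_shift Q y) (fun _ => rfl)
    (fun a => by rw [smul_smul, mul_comm, mul_smul, polar_shift]) fun a => by
      obtain ⟨b, c, rfl⟩ := exists_eq_aeval_add a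
      apply eq_of_add_eq_zero_of_charTwo K
      have h1 := polar_smul Q 𝔲 ((κ b + 𝔱 * κ c) • x) y
      rw [LaurentPolynomial.invert_T, neg_neg] at h1
      rw [← h1, map_add, map_mul, invert_aeval_traceElt, invert_aeval_traceElt,
        LaurentPolynomial.invert_T, smul_smul, ← LinearMap.add_apply, ← map_add, ← add_smul]
      convert hPy' (b + c) using 3
      rw [invert_unipElt, unipElt, map_add]
      have h2 := T_one_mul_T_neg_one (K := K)
      congr 1
      linear_combination -κ b * h2
  refine ⟨s, hs, ?_⟩
  have hy0 : 𝔥 ^ k • y ≠ 0 := by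
    intro h0
    rw [polar_traceElt_pow_smul, h0, map_zero] at hxy
    exact hxy rfl
  have hmap : (𝓢 (Submodule.span 𝓡 {x, y})).map (s - LinearMap.id) =
      LinearMap.range (evalTrace 𝔥 x) ⊔ LinearMap.range (evalTrace 𝔫 y) := by
    have hD : ∀ b c b' c' : K[X],
        (s - LinearMap.id : V →ₗ[K] V) ((κ b + 𝔱 * κ c) • x + (κ b' + 𝔱 * κ c') • y) =
          evalTrace 𝔥 x c + evalTrace 𝔫 y (b' + c') := by
      intro b c b' c'
      rw [LinearMap.sub_apply, hsab, evalTrace_apply, evalTrace_apply, LinearMap.id_apply,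
        smul_smul, add_sub_add_comm, ← sub_smul, ← sub_smul]
      have h2 := T_one_mul_T_neg_one (K := K)
      have h3 : (2 : 𝓡) = 0 := CharTwo.two_eq_zero
      congr 2
      · rw [map_add, map_mul, invert_aeval_traceElt, invert_aeval_traceElt, hu]
        have hT : 𝔥 = 𝔱 + 𝔲 := rfl
        linear_combination (-𝔱 * κ c) * h3 - κ c * hT
      · rw [map_add, map_mul, invert_aeval_traceElt, invert_aeval_traceElt, hu, unipElt, map_add]
        linear_combination κ c' * h2 - (κ b' + 𝔱 * κ c') * h3
    apply le_antisymm
    · rintro _ ⟨v, hv, rfl⟩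
      obtain ⟨a, a', rfl⟩ := Submodule.mem_span_pair.1 hv
      obtain ⟨b, c, rfl⟩ := exists_eq_aeval_add a
      obtain ⟨b', c', rfl⟩ := exists_eq_aeval_add a'
      rw [hD]
      exact Submodule.add_mem_sup ⟨_, rfl⟩ ⟨_, rfl⟩
    · rw [sup_le_iff]
      constructor
      · rintro _ ⟨c, rfl⟩
        refine ⟨_, Submodule.mem_span_pair.2 ⟨κ 0 + 𝔱 * κ c, κ 0 + 𝔱 * κ 0, rfl⟩, ?_⟩
        rw [hD, add_zero, map_zero, add_zero]
      · rintro _ ⟨c, rfl⟩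
        refine ⟨_, Submodule.mem_span_pair.2 ⟨κ 0 + 𝔱 * κ 0, κ c + 𝔱 * κ 0, rfl⟩, ?_⟩
        rw [hD, add_zero, map_zero, zero_add]
  have hdisj : LinearMap.range (evalTrace 𝔥 x) ⊓ LinearMap.range (evalTrace 𝔫 y) = ⊥ := by
    rw [eq_bot_iff]
    intro v hv
    have := hb.disjoint.le ⟨range_evalTrace_le (Submodule.mem_span_singleton_self x) hv.1,
      range_evalTrace_le (Submodule.mem_span_singleton_self y) hv.2⟩
    exact this
  have hker : LinearMap.ker (evalTrace 𝔥 x) = LinearMap.ker (evalTrace 𝔫 y) := by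
    ext c
    rw [LinearMap.mem_ker, LinearMap.mem_ker, evalTrace_apply, evalTrace_apply,
      (key y hy hy0 c).2, ← (key x hx hk0 c).1, map_mul, aeval_X]
  have hsum := Submodule.finrank_sup_add_finrank_inf_eq (LinearMap.range (evalTrace 𝔥 x))
    (LinearMap.range (evalTrace 𝔫 y))
  rw [hdisj, finrank_bot, add_zero, LinearMap.finrank_range_eq_of_ker_eq _ _ hker, ← two_mul]
    at hsum
  rw [hmap, hsum]
  exact even_two_mul _

theorem map_unipElt_smul (w : V) : Q (𝔫 • w) = 𝓑 (𝔱 • w) w := by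
  rw [unipElt, add_smul, one_smul, map_add_polar, map_shift, CharTwo.add_self_eq_zero, zero_add]

theorem polar_unipElt_pow_smul (k : ℕ) (x y : V) :
    𝓑 (𝔫 ^ k • x) (𝔫 ^ k • y) = 𝓑 (𝔥 ^ k • x) y := by
  induction k generalizing x y with
  | zero => simp
  | succ k ih =>
    rw [pow_succ, mul_smul, mul_smul, ih, ← mul_smul, mul_comm, mul_smul, polar_unipElt_smul,
      ← mul_smul, pow_succ']

theorem map_unipElt_pow_succ_smul (k : ℕ) (w : V) :
    Q (𝔫 ^ (k + 1) • w) = 𝓑 ((𝔱 * 𝔥 ^ k) • w) w := by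
  rw [pow_succ', mul_smul, map_unipElt_smul, smul_smul, mul_comm 𝔱 (𝔫 ^ k), mul_smul,
    polar_unipElt_pow_smul, smul_smul, mul_comm]

variable {Q} in
theorem exists_map_unipElt_pow_ne_zero {k : ℕ} {W : Submodule 𝓡 V} (hW : NondegSub Q W)
    {x : V} (hx : x ∈ W) (hx0 : 𝔥 ^ k • x ≠ 0) :
    ∃ z ∈ W, 𝔥 ^ k • z ≠ 0 ∧ Q (𝔫 ^ k • z) ≠ 0 := by
  obtain ⟨y, hy, hxy⟩ : ∃ y ∈ W, 𝓑 (𝔥 ^ k • x) y ≠ 0 := by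
    by_contra! hcon
    exact hx0 (hW _ (W.smul_mem _ hx) hcon)
  have hself : ∀ z, 𝓑 (𝔥 ^ k • z) z = 0 := fun z => by
    have := polar_aeval_smul_self Q (X ^ k) z
    rwa [map_pow, aeval_X] at this
  have hne : ∀ z w, 𝓑 (𝔥 ^ k • z) w ≠ 0 → 𝔥 ^ k • z ≠ 0 := fun z w h h0 => h (by simp [h0])
  by_contra! hcon
  have h1 := hcon x hx hx0
  have h2 := hcon y hy (hne y x (by rwa [polar_traceElt_pow_smul, polar_comm']))
  have h3 := hcon (x + y) (W.add_mem hx hy) (hne (x + y) y (by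
    rwa [smul_add, map_add, LinearMap.add_apply, hself y, add_zero]))
  rw [smul_add, map_add_polar, h1, h2, zero_add, zero_add, polar_unipElt_pow_smul] at h3
  exact hxy h3

variable {Q} in
theorem exists_isBlock_isReverser_odd_rank {k : ℕ} {W : Submodule 𝓡 V} (hW : NondegSub Q W)
    (hN : ∀ x ∈ W, 𝔫 ^ (2 * k + 1) • x = 0) {x : V} (hx : x ∈ W)
    (hx0 : 𝔫 ^ (2 * k) • x ≠ 0) :
    ∃ z ∈ W, ∃ y ∈ W, IsBlock Q (2 * k) z y ∧
      ∃ s : V →ₗ[K] V, IsReverser Q (Submodule.span 𝓡 {z, y}) s ∧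
        Odd (finrank K ((𝓢 (Submodule.span 𝓡 {z, y})).map (s - LinearMap.id))) := by
  have hkz : ∀ z ∈ W, 𝔥 ^ (k + 1) • z = 0 := fun z hz =>
    traceElt_pow_smul_eq (e := 2 * k + 1) (by omega) (hN z hz)
  rw [← traceElt_pow_smul_top (hN x hx)] at hx0
  obtain ⟨z, hz, hz0, hQz⟩ := exists_map_unipElt_pow_ne_zero hW hx hx0
  let ℓ : K[X] →ₗ[K] K :=
    { toFun := fun c => c.coeff 0 * Q z + 𝓑 ((𝔱 * κ (divX c)) • z) z
      map_add' := fun a b => by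
        rw [coeff_add, divX_add, map_add, mul_add, add_smul, map_add, LinearMap.add_apply]
        ring
      map_smul' := fun a b => by
        rw [coeff_smul, show divX (a • b) = a • divX b by ext; simp [coeff_divX],
          show κ (a • divX b) = a • κ (divX b) from map_smul κ a _, mul_smul_comm, smul_assoc, map_smul,
          LinearMap.smul_apply, RingHom.id_apply, smul_eq_mul, smul_eq_mul, smul_eq_mul]
        ring }
  have hℓ : ∀ c, ℓ c = c.coeff 0 * Q z + 𝓑 ((𝔱 * κ (divX c)) • z) z := fun _ => rfl
  have hℓX : ∀ c, ℓ (X * c) = 𝓑 ((𝔱 * κ c) • z) z := fun c => by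
    rw [hℓ, show divX (X * c) = c by ext; simp [coeff_divX], coeff_X_mul_zero, zero_mul, zero_add]
  have hℓ0 : ℓ 1 = Q z := by
    rw [hℓ, divX_one]; simp
  have hℓker : LinearMap.ker (evalTrace 1 z) ≤ LinearMap.ker ℓ := by
    intro c hc
    rw [LinearMap.mem_ker, evalTrace_apply, one_mul,
      aeval_traceElt_smul_eq_zero_iff (hkz z hz) hz0] at hc
    obtain ⟨d, rfl⟩ := hc
    have h1 : 𝔱 • 𝔥 ^ k • z = 𝔥 ^ k • z := by
      apply shift_smul_of_unipElt_smul_eq_zero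
      rw [traceElt_pow_smul_top (hN z hz), smul_smul, ← pow_succ', hN z hz]
    have h2 : (𝔱 * κ (X ^ k * d)) • z = κ (X ^ k * d) • z := by
      rw [mul_comm (X ^ k) d, map_mul, map_pow, aeval_X, mul_left_comm, mul_smul, mul_smul, h1,
        mul_smul]
    rw [LinearMap.mem_ker, pow_succ', mul_assoc, hℓX, h2, polar_aeval_smul_self]
  obtain ⟨ξ, hξ⟩ := LinearMap.exists_comp_eq_of_ker_le _ _ hℓker
  obtain ⟨y, hy, hyW⟩ := hW.exists_polar_eq Q ξ
  have hyz : ∀ c, 𝓑 (κ c • y) z = ℓ c := fun c => by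
    rw [polar_aeval_smul, hyW _ (W.smul_mem _ hz), ← hξ, evalTrace_apply, one_mul]
  have hyz1 : 𝓑 y z = Q z := by
    rw [← hℓ0, ← hyz, map_one, one_smul]
  have htop : 𝓑 (𝔥 ^ k • z) y ≠ 0 := by
    rw [polar_traceElt_pow_smul, polar_comm']
    have h1 := hyz (X ^ k)
    rw [map_pow, aeval_X] at h1
    rw [h1]
    cases k with
    | zero => rw [pow_zero, hℓ0]; simpa using hQz
    | succ k => rwa [pow_succ', hℓX, map_pow, aeval_X, ← map_unipElt_pow_succ_smul]
  have hb := isBlock_of_even hN hz hy htop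
  refine ⟨z, hz, y, hy, hb, ?_⟩
  have hsymm : ∀ a : 𝓡, 𝓑 (a • y) z + 𝓑 (a • z) y = 𝓑 (a • z) z := by
    intro a
    obtain ⟨b, c, rfl⟩ := exists_eq_aeval_add a
    have hT : 𝔥 = 𝔱 + 𝔲 := rfl
    rw [polar_smul Q _ z y, polar_comm' Q z, ← LinearMap.add_apply, ← map_add, ← add_smul,
      map_add, map_mul, invert_aeval_traceElt, invert_aeval_traceElt, LaurentPolynomial.invert_T,
      add_add_add_comm, ← two_mul, CharTwo.two_eq_zero, zero_mul, zero_add, ← add_mul, ← hT,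
      add_smul (κ b), map_add, LinearMap.add_apply (𝓑 _) (𝓑 _), polar_aeval_smul_self, zero_add,
      ← hℓX, ← hyz, map_mul, aeval_X]
  obtain ⟨s, hs, hsab⟩ := exists_isReverser_of_generators Q (x' := z) (y' := z + y) (p := 1)
    (q := 0) (p' := 1) (q' := 1) hb.nondegSub (by simp) (by simp) (by simp)
    (by rw [map_one, one_smul, one_smul, ← add_assoc, add_self_of_charTwo K, zero_add])
    rfl
    (by rw [map_add_polar, polar_comm', hyz1, add_right_comm, CharTwo.add_self_eq_zero, zero_add])
    (fun _ => rfl)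
    (fun a => by
      simp only [smul_add, map_add, LinearMap.add_apply]
      have h1 := hsymm a
      have h2 : (2 : K) = 0 := CharTwo.two_eq_zero
      linear_combination h1 + 𝓑 (a • z) z * h2) fun a => by
      have h1 := hsymm a
      have h2 : (2 : K) = 0 := CharTwo.two_eq_zero
      have h3 : 𝓑 (invert a • z) y = 𝓑 (a • y) z := by rw [polar_smul Q a y, polar_comm']
      rw [map_add, h3]
      linear_combination -h1 + 𝓑 (a • z) y * h2
  refine ⟨s, hs, ?_⟩
  set U := Submodule.span 𝓡 {z, y} with hU
  set D : V →ₗ[K] V := s - LinearMap.id with hD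
  have hDU : (𝓢 U).map D ≤ 𝓢 U ⊓ LinearMap.ker D := by
    rintro _ ⟨v, hv, rfl⟩
    refine ⟨U.sub_mem (hs.mem v hv) hv, ?_⟩
    have h1 : D (D v) = (v + v) - (s v + s v) := by
      rw [hD, LinearMap.sub_apply, LinearMap.sub_apply, map_sub, LinearMap.id_apply,
        LinearMap.id_apply, hs.invol v hv]
      abel
    rw [add_self_of_charTwo K, add_self_of_charTwo K, sub_zero] at h1
    exact h1
  have hdimU := hb.finrank_eq
  have hle := Submodule.finrank_mono hDU
  have hrn := Submodule.finrank_map_add_finrank_inf_ker D (𝓢 U)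
  have hge : 𝓢 U ≤ 𝓢 (Submodule.span 𝓡 {y}) ⊔ (𝓢 U).map D := by
    intro v hv
    obtain ⟨a, b, rfl⟩ := Submodule.mem_span_pair.1 hv
    have h1 : D (invert a • y) = a • z + (a - invert a) • y := by
      have := hsab 0 (invert a)
      simp only [map_zero, zero_smul, zero_add, invert_invert_apply] at this
      rw [hD, LinearMap.sub_apply, this, LinearMap.id_apply, sub_smul, smul_add]
      abel
    have h2 : a • z + b • y = (b - (a - invert a)) • y + D (invert a • y) := by
      rw [h1, sub_smul]
      abel
    rw [h2]
    exact Submodule.add_mem_sup (Submodule.smul_mem _ _ (Submodule.mem_span_singleton_self y))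
      ⟨_, U.smul_mem (invert a) (Submodule.subset_span (Set.mem_insert_of_mem z rfl)), rfl⟩
  have hge' := (Submodule.finrank_mono hge).trans (Submodule.finrank_add_le_finrank_add_finrank _ _)
  have hy' := finrank_span_singleton_le hb.pow_right
  rw [← hU] at hdimU
  exact ⟨k, by omega⟩

theorem exists_unipElt_exponent {W : Submodule 𝓡 V} (hW : W ≠ ⊥)
    (hn : ∃ m, ∀ x ∈ W, 𝔫 ^ m • x = 0) :
    ∃ e, (∀ x ∈ W, 𝔫 ^ (e + 1) • x = 0) ∧ ∃ x ∈ W, 𝔫 ^ e • x ≠ 0 := by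
  classical
  have h1 := Nat.find_spec hn
  obtain ⟨e, he⟩ : ∃ e, Nat.find hn = e + 1 := by
    refine Nat.exists_eq_succ_of_ne_zero fun h0 => hW ?_
    rw [h0] at h1
    exact (Submodule.eq_bot_iff _).2 fun x hx => by simpa using h1 x hx
  rw [he] at h1
  refine ⟨e, h1, ?_⟩
  have h2 := Nat.find_min hn (m := e) (by omega)
  push Not at h2
  exact h2

variable {Q} in
theorem NondegSub.cases_of_unip {W : Submodule 𝓡 V} (hW : W ≠ ⊥)
    (hn : ∃ m, ∀ x ∈ W, 𝔫 ^ m • x = 0) :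
    (∃ x ∈ W, x ≠ 0 ∧ NondegSub Q (Submodule.span 𝓡 {x})) ∨
    (∃ k, (∀ x ∈ W, 𝔫 ^ (2 * k + 2) • x = 0) ∧ (∀ x ∈ W, 𝓑 (𝔫 ^ (2 * k + 1) • x) x = 0) ∧
      ∃ x ∈ W, 𝔫 ^ (2 * k + 1) • x ≠ 0) ∨
    ∃ k, (∀ x ∈ W, 𝔫 ^ (2 * k + 1) • x = 0) ∧ ∃ x ∈ W, 𝔫 ^ (2 * k) • x ≠ 0 := by
  obtain ⟨e, he, x, hx, hx0⟩ := exists_unipElt_exponent hW hn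
  rcases Nat.even_or_odd' e with ⟨k, rfl | rfl⟩
  · exact Or.inr (Or.inr ⟨k, he, x, hx, hx0⟩)
  by_cases hself : ∀ x ∈ W, 𝓑 (𝔫 ^ (2 * k + 1) • x) x = 0
  · exact Or.inr (Or.inl ⟨k, he, hself, x, hx, hx0⟩)
  push Not at hself
  obtain ⟨z, hz, hzz⟩ := hself
  refine Or.inl ⟨z, hz, ?_, nondegSub_span_singleton_of_unip Q (he z hz) hzz⟩
  rintro rfl
  exact hzz (map_zero _)

theorem span_pair_le {x y : V} {W : Submodule 𝓡 V} (hx : x ∈ W) (hy : y ∈ W) :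
    Submodule.span 𝓡 {x, y} ≤ W :=
  Submodule.span_le.2 (Set.insert_subset hx (Set.singleton_subset_iff.2 hy))

theorem span_pair_ne_bot {x y : V} (hx : x ≠ 0) : Submodule.span 𝓡 {x, y} ≠ ⊥ := fun h =>
  hx ((Submodule.mem_bot 𝓡).1 (h ▸ Submodule.subset_span (Set.mem_insert x {y})))

theorem ne_zero_of_smul_ne_zero {a : 𝓡} {x : V} (hx : a • x ≠ 0) : x ≠ 0 := by
  rintro rfl
  exact hx (smul_zero a)

variable {Q} in
theorem NondegSub.exists_le_isReverser {W : Submodule 𝓡 V} (hW : NondegSub Q W) (h0 : W ≠ ⊥) :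
    ∃ Y ≤ W, Y ≠ ⊥ ∧ NondegSub Q Y ∧ ∃ s : V →ₗ[K] V, IsReverser Q Y s := by
  have hcyc : (∃ x ∈ W, x ≠ 0 ∧ NondegSub Q (Submodule.span 𝓡 {x})) →
      ∃ Y ≤ W, Y ≠ ⊥ ∧ NondegSub Q Y ∧ ∃ s : V →ₗ[K] V, IsReverser Q Y s := by
    rintro ⟨x, hx, hx0, hxn⟩
    exact ⟨_, (Submodule.span_singleton_le_iff_mem _ _).2 hx,
      fun h => hx0 (Submodule.span_singleton_eq_bot.1 h), hxn, exists_isReverser_span_singleton hxn⟩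
  by_cases hn : ∃ m, ∀ x ∈ W, 𝔫 ^ m • x = 0
  · obtain h | ⟨k, hk, hself, x, hx, hx0⟩ | ⟨k, hk, x, hx, hx0⟩ :=
      NondegSub.cases_of_unip (Q := Q) h0 hn
    · exact hcyc h
    · obtain ⟨y, hy, hb, hs⟩ := exists_isBlock_isReverser_of_odd hW hk hself hx hx0
      exact ⟨_, span_pair_le hx hy, span_pair_ne_bot (ne_zero_of_smul_ne_zero hx0), hb.nondegSub, hs⟩
    · obtain ⟨y, hy, hb, s, hs, -⟩ := exists_isBlock_isReverser_even_rank hW hk hx hx0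
      exact ⟨_, span_pair_le hx hy, span_pair_ne_bot (ne_zero_of_smul_ne_zero hx0), hb.nondegSub,
        s, hs⟩
  · exact hcyc (hW.exists_span_singleton_of_not_unip hn)

theorem finrank_pos_of_ne_bot {W : Submodule 𝓡 V} (hW : W ≠ ⊥) : 0 < finrank K (𝓢 W) :=
  Nat.pos_of_ne_zero fun h => hW <| by
    rw [Submodule.finrank_eq_zero, Submodule.restrictScalars_eq_bot_iff] at h
    exact h

variable {Q} in
/-- Every isometry is inverted by an isometric involution. -/
theorem NondegSub.exists_isReverser {W : Submodule 𝓡 V} (hW : NondegSub Q W) :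
    ∃ s : V →ₗ[K] V, IsReverser Q W s := by
  induction hd : finrank K (𝓢 W) using Nat.strong_induction_on generalizing W with
  | _ d ih =>
    by_cases h0 : W = ⊥
    · subst h0
      refine ⟨LinearMap.id, ?_, ?_, ?_, ?_⟩ <;> intro x hx <;> rw [Submodule.mem_bot] at hx <;>
        simp [hx]
    obtain ⟨Y, hYW, hY0, hY, s₁, h₁⟩ := hW.exists_le_isReverser h0
    obtain ⟨hZ, hb, hs⟩ := hY.splitting Q hW hYW
    have hdim := finrank_add_eq_of_splitting hb hs
    have hpos := finrank_pos_of_ne_bot hY0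
    obtain ⟨s₂, h₂⟩ := ih _ (by omega) hZ rfl
    obtain ⟨s, hs', -⟩ := IsReverser.glue Q hY inf_le_right h₁ h₂
    exact ⟨s, hs ▸ hs'⟩

variable (K V) in
/-- Multiplication by `t` as an endomorphism. -/
noncomputable def shiftMap : V →ₗ[K] V := Algebra.lsmul K K V 𝔱

/-- `t` acts as a product of two isometric involutions with even-dimensional residual spaces. -/
def IsBireflective : Prop :=
  ∃ s s' : V →ₗ[K] V, (∀ x, Q (s x) = Q x) ∧ (∀ x, Q (s' x) = Q x) ∧ (∀ x, s (s x) = x) ∧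
    (∀ x, s' (s' x) = x) ∧ Even (finrank K (LinearMap.range (s - LinearMap.id))) ∧
    Even (finrank K (LinearMap.range (s' - LinearMap.id))) ∧ ∀ x, 𝔱 • x = s (s' x)

theorem polarBilin_nondegenerate_of_nondegSub_top (hV : NondegSub Q ⊤) : (𝓑).Nondegenerate :=
  ⟨fun x h => hV x trivial fun y _ => h y,
    fun x h => hV x trivial fun y _ => by rw [polar_comm']; exact h y⟩

theorem even_finrank_of_nondegSub_top (hV : NondegSub Q ⊤) : Even (finrank K V) := by
  have := hV.even_finrank
  rwa [Submodule.restrictScalars_top, finrank_top] at this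

theorem isBireflective_of_isReverser (hV : NondegSub Q ⊤)
    (hφ : Even (finrank K (LinearMap.range (shiftMap K V - LinearMap.id)))) {s : V →ₗ[K] V}
    (hs : IsReverser Q ⊤ s) (hr : Even (finrank K (LinearMap.range (s - LinearMap.id)))) :
    IsBireflective Q := by
  let s' : V →ₗ[K] V := s ∘ₗ shiftMap K V
  have hs' : IsReverser Q ⊤ s' := hs.comp_shift Q fun _ => rfl
  refine ⟨s, s', fun x => hs.map_form x trivial, fun x => hs'.map_form x trivial,
    fun x => hs.invol x trivial, fun x => hs'.invol x trivial, hr, ?_, fun x => ?_⟩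
  · have h := even_finrank_ker_of_isometry Q (polarBilin_nondegenerate_of_nondegSub_top Q hV)
      (a := s) (b := shiftMap K V) (fun x => hs.map_form x trivial) (fun x => map_shift Q x)
    have hk : LinearMap.ker (s - shiftMap K V) = LinearMap.ker (s' - LinearMap.id) := by
      ext x
      rw [LinearMap.mem_ker, LinearMap.mem_ker, LinearMap.sub_apply, LinearMap.sub_apply,
        sub_eq_zero, sub_eq_zero]
      change s x = 𝔱 • x ↔ s (𝔱 • x) = x
      constructor
      · intro h
        rw [← h, hs.invol x trivial]
      · intro h
        conv_lhs => rw [← h]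
        exact hs.invol _ trivial
    rw [hk] at h
    have hn := even_finrank_of_nondegSub_top Q hV
    have h1 := LinearMap.finrank_range_add_finrank_ker (s - LinearMap.id)
    have h2 := LinearMap.finrank_range_add_finrank_ker (shiftMap K V - LinearMap.id)
    have h3 := LinearMap.finrank_range_add_finrank_ker (s' - LinearMap.id)
    rw [Nat.even_iff] at *
    omega
  · exact (hs.invol (𝔱 • x) trivial).symm

theorem finrank_range_glue {U Z : Submodule 𝓡 V} (hb : U ⊓ Z = ⊥) (ht : U ⊔ Z = ⊤)
    {s s₁ s₂ : V →ₗ[K] V}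
    (h₁ : ∀ x ∈ U, s₁ x ∈ U) (h₂ : ∀ z ∈ Z, s₂ z ∈ Z) (e₁ : ∀ x ∈ U, s x = s₁ x)
    (e₂ : ∀ z ∈ Z, s z = s₂ z) : finrank K (LinearMap.range (s - LinearMap.id)) =
      finrank K ((𝓢 U).map (s₁ - LinearMap.id)) + finrank K ((𝓢 Z).map (s₂ - LinearMap.id)) := by
  rw [← finrank_map_glue hb h₁ h₂ e₁ e₂, ht, Submodule.restrictScalars_top, Submodule.map_top]

theorem isBireflective_of_exists_parity (hV : NondegSub Q ⊤)
    (hφ : Even (finrank K (LinearMap.range (shiftMap K V - LinearMap.id)))) {U : Submodule 𝓡 V}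
    (hU : NondegSub Q U) {a b : V →ₗ[K] V} (ha : IsReverser Q U a) (hb : IsReverser Q U b)
    (hab : Odd (finrank K ((𝓢 U).map (a - LinearMap.id)) +
      finrank K ((𝓢 U).map (b - LinearMap.id)))) : IsBireflective Q := by
  obtain ⟨hZ, hbot, htop⟩ := hU.splitting Q hV le_top
  obtain ⟨c, hc⟩ := hZ.exists_isReverser
  have key : ∀ {a : V →ₗ[K] V}, IsReverser Q U a →
      Even (finrank K ((𝓢 U).map (a - LinearMap.id)) +
        finrank K ((𝓢 (⊤ ⊓ orthSub Q U)).map (c - LinearMap.id))) → IsBireflective Q := by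
    intro a ha he
    obtain ⟨s, hs, e₁, e₂⟩ := IsReverser.glue Q hU inf_le_right ha hc
    rw [htop] at hs
    refine isBireflective_of_isReverser Q hV hφ hs ?_
    rwa [finrank_range_glue hbot htop ha.mem hc.mem e₁ e₂]
  by_cases he : Even (finrank K ((𝓢 U).map (a - LinearMap.id)) +
        finrank K ((𝓢 (⊤ ⊓ orthSub Q U)).map (c - LinearMap.id)))
  · exact key ha he
  · refine key hb ?_
    rw [Nat.even_iff] at *
    rw [Nat.odd_iff] at hab
    omega

theorem exists_unipElt_smul_eq_zero {U : Submodule 𝓡 V} (hU : U ≠ ⊥)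
    (hn : ∃ m, ∀ x ∈ U, 𝔫 ^ m • x = 0) : ∃ z ∈ U, z ≠ 0 ∧ 𝔫 • z = 0 := by
  obtain ⟨e, he, x, hx, hx0⟩ := exists_unipElt_exponent hU hn
  refine ⟨𝔫 ^ e • x, U.smul_mem _ hx, hx0, ?_⟩
  rw [smul_smul, ← pow_succ', he x hx]

variable (K V) in
/-- Multiplication by `n = t + 1` as an endomorphism. -/
noncomputable def unipMap : V →ₗ[K] V := Algebra.lsmul K K V 𝔫

theorem finrank_inf_ker_unipMap {x : V} (hx : x ≠ 0)
    (hn : ∃ m, ∀ y ∈ Submodule.span 𝓡 {x}, 𝔫 ^ m • y = 0) :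
    finrank K (𝓢 (Submodule.span 𝓡 {x}) ⊓ LinearMap.ker (unipMap K V) : Submodule K V) = 1 := by
  have h1 := Submodule.finrank_map_add_finrank_inf_ker (unipMap K V) (𝓢 (Submodule.span 𝓡 {x}))
  apply le_antisymm
  · have hle : 𝓢 (Submodule.span 𝓡 {x}) ≤
        Submodule.span K {x} ⊔ (𝓢 (Submodule.span 𝓡 {x})).map (unipMap K V) := by
      intro v hv
      obtain ⟨r, rfl⟩ := Submodule.mem_span_singleton.1 hv
      obtain ⟨a, ha⟩ := exists_smul_eq_aeval_unipElt_smul r x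
      rw [ha, ← Polynomial.divX_mul_X_add a, map_add, map_mul, aeval_X, aeval_C, add_comm,
        add_smul]
      refine Submodule.add_mem_sup ?_ ?_
      · rw [algebraMap_smul]
        exact Submodule.smul_mem _ _ (Submodule.mem_span_singleton_self x)
      · refine ⟨aeval 𝔫 a.divX • x, Submodule.smul_mem _ _ (Submodule.mem_span_singleton_self x), ?_⟩
        change 𝔫 • (aeval 𝔫 a.divX • x) = _
        rw [smul_smul, mul_comm]
    have h2 := (Submodule.finrank_mono hle).trans (Submodule.finrank_add_le_finrank_add_finrank _ _)
    rw [finrank_span_singleton hx] at h2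
    omega
  · obtain ⟨z, hz, hz0, hz'⟩ := exists_unipElt_smul_eq_zero
      (fun h => hx (Submodule.span_singleton_eq_bot.1 h)) hn
    rw [Nat.one_le_iff_ne_zero, Ne, Submodule.finrank_eq_zero]
    intro h
    exact hz0 ((Submodule.mem_bot K).1 (h ▸ ⟨hz, hz'⟩))

/-- On a cyclic unipotent submodule, a reverser and its shift have ranks of opposite parity. -/
theorem isBireflective_of_cyclic (hV : NondegSub Q ⊤)
    (hφ : Even (finrank K (LinearMap.range (shiftMap K V - LinearMap.id)))) {x : V} (hx : x ≠ 0)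
    (hU : NondegSub Q (Submodule.span 𝓡 {x}))
    (hn : ∃ m, ∀ y ∈ Submodule.span 𝓡 {x}, 𝔫 ^ m • y = 0) : IsBireflective Q := by
  obtain ⟨a, ha⟩ := hU.exists_isReverser
  let b : V →ₗ[K] V := a ∘ₗ shiftMap K V
  have hb : IsReverser Q (Submodule.span 𝓡 {x}) b := ha.comp_shift Q fun _ => rfl
  refine isBireflective_of_exists_parity Q hV hφ hU ha hb ?_
  obtain ⟨hZ, hbot, htop⟩ := hU.splitting Q hV le_top
  obtain ⟨c, hc⟩ := hZ.exists_isReverser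
  obtain ⟨s, hs, s₁, s₂⟩ := IsReverser.glue Q hU inf_le_right ha hc
  obtain ⟨s', hs', s₁', s₂'⟩ := IsReverser.glue Q hU inf_le_right hb hc
  have r := finrank_range_glue hbot htop ha.mem hc.mem s₁ s₂
  have r' := finrank_range_glue hbot htop hb.mem hc.mem s₁' s₂'
  rw [htop] at hs hs'
  have h := even_finrank_ker_of_isometry Q (polarBilin_nondegenerate_of_nondegSub_top Q hV)
    (a := s) (b := s') (fun x => hs.map_form x trivial) (fun x => hs'.map_form x trivial)
  have hrange : LinearMap.range (s - s') = (𝓢 (Submodule.span 𝓡 {x})).map (s - s') := by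
    rw [← Submodule.map_top, ← Submodule.restrictScalars_top (S := K) (R := 𝓡), ← htop,
      Submodule.restrictScalars_sup, Submodule.map_sup, sup_eq_left]
    rintro _ ⟨z, hz, rfl⟩
    rw [LinearMap.sub_apply, s₂ z hz, s₂' z hz, sub_self]
    exact Submodule.zero_mem _
  have hker : 𝓢 (Submodule.span 𝓡 {x}) ⊓ LinearMap.ker (s - s') =
      𝓢 (Submodule.span 𝓡 {x}) ⊓ LinearMap.ker (unipMap K V) := by
    ext v
    refine and_congr_right fun hv => ?_
    change (s - s') v = 0 ↔ 𝔫 • v = 0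
    rw [LinearMap.sub_apply, s₁ v hv, s₁' v hv]
    change a v - a (𝔱 • v) = 0 ↔ 𝔫 • v = 0
    have e : a v - a (𝔱 • v) = a (𝔫 • v) := by
      rw [unipElt, add_smul, one_smul, map_add, sub_eq_iff_eq_add, add_comm, ← add_assoc,
        add_self_of_charTwo K (a (𝔱 • v)), zero_add]
    rw [e]
    constructor
    · intro h
      rw [← ha.invol (𝔫 • v) (Submodule.smul_mem _ _ hv), h, map_zero]
    · intro h
      rw [h, map_zero]
  have h1 := Submodule.finrank_map_add_finrank_inf_ker (s - s') (𝓢 (Submodule.span 𝓡 {x}))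
  rw [← hrange, hker, finrank_inf_ker_unipMap hx hn] at h1
  have h2 := LinearMap.finrank_range_add_finrank_ker (s - s')
  have h3 := hU.even_finrank
  have h4 := even_finrank_of_nondegSub_top Q hV
  have h5 := LinearMap.finrank_range_add_finrank_ker (s - LinearMap.id)
  have h6 := LinearMap.finrank_range_add_finrank_ker (s' - LinearMap.id)
  rw [Nat.even_iff] at *
  rw [Nat.odd_iff]
  omega

theorem isBireflective_of_indecomposable (hV : NondegSub Q ⊤)
    (hφ : Even (finrank K (LinearMap.range (shiftMap K V - LinearMap.id)))) {U : Submodule 𝓡 V}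
    (hU0 : U ≠ ⊥) (hU : NondegSub Q U) (hn : ∃ m, ∀ y ∈ U, 𝔫 ^ m • y = 0)
    (hind : ∀ W ≤ U, NondegSub Q W → W ≠ ⊥ → W = U) (hd : finrank K (𝓢 U) % 4 = 2) :
    IsBireflective Q := by
  obtain ⟨x, hx, hx0, hxn⟩ | ⟨k, hk, hself, x, hx, hx0⟩ | ⟨k, hk, x, hx, hx0⟩ :=
      NondegSub.cases_of_unip (Q := Q) hU0 hn
  · have := hind _ ((Submodule.span_singleton_le_iff_mem _ _).2 hx) hxn
      fun h => hx0 (Submodule.span_singleton_eq_bot.1 h)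
    subst this
    exact isBireflective_of_cyclic Q hV hφ hx0 hxn hn
  · obtain ⟨y, hy, hb, -⟩ := exists_isBlock_isReverser_of_odd hU hk hself hx hx0
    have := hind _ (span_pair_le hx hy) hb.nondegSub
      (span_pair_ne_bot (ne_zero_of_smul_ne_zero hx0))
    rw [← this, hb.finrank_eq] at hd
    omega
  · obtain ⟨y, hy, hb, a, ha, hae⟩ := exists_isBlock_isReverser_even_rank hU hk hx hx0
    have h1 := hind _ (span_pair_le hx hy) hb.nondegSub
      (span_pair_ne_bot (ne_zero_of_smul_ne_zero hx0))
    obtain ⟨z, hz, y', hy', hb', b, hb2, hbo⟩ := exists_isBlock_isReverser_odd_rank hU hk hx hx0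
    have hz0 : z ≠ 0 := ne_zero_of_smul_ne_zero (a := 𝔫 ^ (2 * k)) fun h => hb'.polar_ne (by
      rw [h, map_zero, LinearMap.zero_apply])
    have h2 := hind _ (span_pair_le hz hy') hb'.nondegSub (span_pair_ne_bot hz0)
    rw [h1] at ha hae
    rw [h2] at hb2 hbo
    exact isBireflective_of_exists_parity Q hV hφ hU ha hb2 (hae.add_odd hbo)

theorem unipElt_pow_smul_eq_zero_of_mem_span_pair {e : ℕ} {x y : V} (hx : 𝔫 ^ e • x = 0)
    (hy : 𝔫 ^ e • y = 0) {v : V} (hv : v ∈ Submodule.span 𝓡 {x, y}) : 𝔫 ^ e • v = 0 := by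
  obtain ⟨r, s, rfl⟩ := Submodule.mem_span_pair.1 hv
  rw [smul_add, smul_comm _ r, smul_comm _ s, hx, hy, smul_zero, smul_zero, add_zero]

variable {Q} in
/-- A block of even exponent has no nondegenerate submodules. -/
theorem IsBlock.eq_of_le {k : ℕ} {x y : V} (hb : IsBlock Q (2 * k) x y) {W : Submodule 𝓡 V}
    (hWU : W ≤ Submodule.span 𝓡 {x, y}) (hW : NondegSub Q W) (hW0 : W ≠ ⊥) :
    W = Submodule.span 𝓡 {x, y} := by
  have hN : ∀ v ∈ Submodule.span 𝓡 {x, y}, 𝔫 ^ (2 * k + 1) • v = 0 := fun v =>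
    unipElt_pow_smul_eq_zero_of_mem_span_pair hb.pow_left hb.pow_right
  have key : ∀ Y ≤ Submodule.span 𝓡 {x, y}, NondegSub Q Y → (∃ w ∈ Y, 𝔫 ^ (2 * k) • w ≠ 0) →
      Y = Submodule.span 𝓡 {x, y} := by
    rintro Y hYU hY ⟨w, hw, hw0⟩
    obtain ⟨w', hw', hb', -⟩ :=
      exists_isBlock_isReverser_even_rank hY (fun v hv => hN v (hYU hv)) hw hw0
    have h1 := span_pair_le hw hw'
    have h2 : 𝓢 (Submodule.span 𝓡 {w, w'}) = 𝓢 (Submodule.span 𝓡 {x, y}) :=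
      Submodule.eq_of_le_of_finrank_eq (fun v hv => hYU (h1 hv)) (by
        rw [hb.finrank_eq, hb'.finrank_eq])
    exact le_antisymm hYU (Submodule.restrictScalars_injective K _ _ h2 ▸ h1)
  obtain ⟨hZ, hbot, htop⟩ := hW.splitting Q hb.nondegSub hWU
  by_cases h : ∃ w ∈ W, 𝔫 ^ (2 * k) • w ≠ 0
  · exact key W hWU hW h
  · exfalso
    push Not at h
    have hx : x ∈ W ⊔ (Submodule.span 𝓡 {x, y} ⊓ orthSub Q W) :=
      htop.symm ▸ Submodule.subset_span (Set.mem_insert x {y})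
    obtain ⟨w, hw, z, hz, hwz⟩ := Submodule.mem_sup.1 hx
    have hz0 : 𝔫 ^ (2 * k) • z ≠ 0 := by
      intro hz0
      apply hb.polar_ne
      rw [← hwz, smul_add, h w hw, hz0, add_zero, map_zero, LinearMap.zero_apply]
    have h2 := key _ inf_le_left hZ ⟨z, hz, hz0⟩
    rw [h2, inf_eq_left.2 hWU] at hbot
    exact hW0 hbot

/-- The intersection of the kernel and the image of `n ^ j`, within `W`. -/
noncomputable def layer (W : Submodule (LaurentPolynomial K) V) (j : ℕ) :
    Submodule (LaurentPolynomial K) V :=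
  W ⊓ (LinearMap.range (LinearMap.lsmul 𝓡 V (𝔫 ^ j)) ⊓
    LinearMap.ker (LinearMap.lsmul 𝓡 V (𝔫 ^ j)))

theorem mem_layer {W : Submodule 𝓡 V} {j : ℕ} {x : V} :
    x ∈ layer W j ↔ x ∈ W ∧ (∃ v, 𝔫 ^ j • v = x) ∧ 𝔫 ^ j • x = 0 := Iff.rfl

/-- The sum of all `layer W j`. -/
noncomputable def layerSum (W : Submodule (LaurentPolynomial K) V) :
    Submodule (LaurentPolynomial K) V := ⨆ j, layer W j

theorem layerSum_le (W : Submodule 𝓡 V) : layerSum W ≤ W := iSup_le fun _ => inf_le_left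

theorem polar_layer_of_le {W : Submodule 𝓡 V} {i j : ℕ} (hij : i ≤ j) {x y : V}
    (hx : x ∈ layer W i) (hy : y ∈ layer W j) : 𝓑 y x = 0 := by
  obtain ⟨-, -, hx0⟩ := mem_layer.1 hx
  obtain ⟨-, ⟨v, rfl⟩, -⟩ := mem_layer.1 hy
  obtain ⟨d, rfl⟩ := Nat.exists_eq_add_of_le' hij
  rw [polar_smul, invert_unipElt_pow, pow_add, mul_smul, mul_smul, hx0, smul_zero, smul_zero,
    map_zero]

theorem polar_layerSum {W : Submodule 𝓡 V} {x y : V} (hx : x ∈ layerSum W)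
    (hy : y ∈ layerSum W) : 𝓑 x y = 0 := by
  have h1 : ∀ j, layerSum W ≤ orthSub Q (layer W j) := fun j => iSup_le fun i z hz w hw => by
    rcases le_total i j with h | h
    · exact polar_layer_of_le Q h hz hw
    · rw [polar_comm']
      exact polar_layer_of_le Q h hw hz
  have h2 : layerSum W ≤ orthSub Q (layerSum W) := iSup_le fun j z hz w hw => by
    rw [polar_comm']
    exact h1 j hw z hz
  exact h2 hy x hx

theorem map_layer {W : Submodule 𝓡 V}
    (hc : ∀ (k : ℕ) (x : V), 𝔫 ^ (2 * k + 2) • x = 0 → 𝓑 (𝔫 ^ (2 * k + 1) • x) x = 0) {j : ℕ}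
    {x : V} (hx : x ∈ layer W j) : Q x = 0 := by
  obtain ⟨-, ⟨v, rfl⟩, hv⟩ := mem_layer.1 hx
  cases j with
  | zero =>
    rw [pow_zero, one_smul, one_smul] at hv
    rw [hv, smul_zero, QuadraticMap.map_zero]
  | succ k =>
    rw [smul_smul, ← pow_add, show k + 1 + (k + 1) = 2 * k + 2 by ring] at hv
    rw [map_unipElt_pow_succ_smul, polar_shift_traceElt_pow Q hv, hc k v hv]

theorem map_layerSum {W : Submodule 𝓡 V}
    (hc : ∀ (k : ℕ) (x : V), 𝔫 ^ (2 * k + 2) • x = 0 → 𝓑 (𝔫 ^ (2 * k + 1) • x) x = 0)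
    {x : V} (hx : x ∈ layerSum W) : Q x = 0 := by
  refine Submodule.iSup_induction' (layer W) (motive := fun x _ => Q x = 0)
    (fun j x hx => map_layer Q hc hx) (QuadraticMap.map_zero Q) (fun x y hx hy h1 h2 => ?_) hx
  rw [map_add_polar, h1, h2, polar_layerSum Q hx hy, add_zero, add_zero]

theorem finrank_span_pair_le_add (x y : V) : finrank K (𝓢 (Submodule.span 𝓡 {x, y})) ≤
    finrank K (𝓢 (Submodule.span 𝓡 {𝔫 • x, 𝔫 • y})) + 2 := by
  have h1 : ∀ (r : 𝓡) (z : V), ∃ α : K, ∃ q : 𝓡, r • z = α • z + q • 𝔫 • z := by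
    intro r z
    obtain ⟨a, ha⟩ := exists_smul_eq_aeval_unipElt_smul r z
    refine ⟨a.coeff 0, aeval 𝔫 a.divX, ?_⟩
    rw [ha]
    conv_lhs => rw [← Polynomial.divX_mul_X_add a]
    rw [map_add, map_mul, aeval_X, aeval_C, add_comm, add_smul, algebraMap_smul, mul_smul]
  have hle : 𝓢 (Submodule.span 𝓡 {x, y}) ≤
      𝓢 (Submodule.span 𝓡 {𝔫 • x, 𝔫 • y}) ⊔ (Submodule.span K {x} ⊔ Submodule.span K {y}) := by
    intro v hv
    obtain ⟨r, s, rfl⟩ := Submodule.mem_span_pair.1 hv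
    obtain ⟨α, q, h⟩ := h1 r x
    obtain ⟨β, q', h'⟩ := h1 s y
    rw [h, h', show α • x + q • 𝔫 • x + (β • y + q' • 𝔫 • y) =
      (q • 𝔫 • x + q' • 𝔫 • y) + (α • x + β • y) by abel]
    refine Submodule.add_mem_sup (Submodule.mem_span_pair.2 ⟨q, q', rfl⟩)
      (Submodule.add_mem_sup ?_ ?_)
    · exact Submodule.smul_mem _ _ (Submodule.mem_span_singleton_self x)
    · exact Submodule.smul_mem _ _ (Submodule.mem_span_singleton_self y)
  have hone : ∀ z : V, finrank K (Submodule.span K {z}) ≤ 1 := fun z => by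
    simpa using finrank_span_le_card (R := K) ({z} : Set V)
  have h2 := (Submodule.finrank_mono hle).trans (Submodule.finrank_add_le_finrank_add_finrank _ _)
  have h3 := Submodule.finrank_add_le_finrank_add_finrank (Submodule.span K {x})
    (Submodule.span K {y})
  have h4 := hone x
  have h5 := hone y
  omega

theorem finrank_span_pair_le_add_pow (x y : V) (j : ℕ) :
    finrank K (𝓢 (Submodule.span 𝓡 {x, y})) ≤
      finrank K (𝓢 (Submodule.span 𝓡 {𝔫 ^ j • x, 𝔫 ^ j • y})) + 2 * j := by
  induction j with
  | zero => rw [pow_zero, one_smul, one_smul, mul_zero, add_zero]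
  | succ j ih =>
    have := finrank_span_pair_le_add (K := K) (𝔫 ^ j • x) (𝔫 ^ j • y)
    rw [smul_smul, smul_smul, ← pow_succ'] at this
    omega

/-- In the absence of cyclic nondegenerate submodules and blocks of even exponent, `layerSum`
is a Lagrangian. -/
theorem finrank_le_two_mul_layerSum {W : Submodule 𝓡 V} {M : ℕ} (hM : ∀ x ∈ W, 𝔫 ^ M • x = 0)
    (hcyc : ∀ x : V, x ≠ 0 → (∃ m, 𝔫 ^ m • x = 0) → ¬ NondegSub Q (Submodule.span 𝓡 {x}))
    (hblock : ∀ (k : ℕ) (x y : V), ¬ IsBlock Q (2 * k) x y)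
    {Y : Submodule 𝓡 V} (hYW : Y ≤ W) (hY : NondegSub Q Y) :
    finrank K (𝓢 Y) ≤ 2 * finrank K (𝓢 (layerSum W ⊓ Y)) ∧ 4 ∣ finrank K (𝓢 Y) := by
  induction hd : finrank K (𝓢 Y) using Nat.strong_induction_on generalizing Y with
  | _ d ih =>
    by_cases h0 : Y = ⊥
    · rw [h0, Submodule.restrictScalars_bot, finrank_bot] at hd
      subst hd
      simp
    obtain ⟨x, hx, hx0, hxn⟩ | ⟨k, hk, hself, x, hx, hx0⟩ | ⟨k, hk, x, hx, hx0⟩ :=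
      NondegSub.cases_of_unip (Q := Q) h0 ⟨M, fun x hx => hM x (hYW hx)⟩
    · exact absurd hxn (hcyc x hx0 ⟨M, hM x (hYW hx)⟩)
    · obtain ⟨y, hy, hb, -⟩ := exists_isBlock_isReverser_of_odd hY hk hself hx hx0
      have hle := span_pair_le hx hy
      obtain ⟨hZ, hbot, htop⟩ := hb.nondegSub.splitting Q hY hle
      have hdim := finrank_add_eq_of_splitting hbot htop
      have hU := hb.finrank_eq
      obtain ⟨ih1, ih2⟩ := ih _ (by omega) (inf_le_left.trans hYW) hZ rfl
      have hS : Submodule.span 𝓡 {𝔫 ^ (k + 1) • x, 𝔫 ^ (k + 1) • y} ≤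
          layerSum W ⊓ Submodule.span 𝓡 {x, y} := by
        have key : ∀ z ∈ Submodule.span 𝓡 {x, y},
            𝔫 ^ (k + 1) • z ∈ layerSum W ⊓ Submodule.span 𝓡 {x, y} := by
          intro z hz
          refine ⟨Submodule.mem_iSup_of_mem (k + 1) (mem_layer.2
            ⟨W.smul_mem _ (hYW (hle hz)), ⟨z, rfl⟩, ?_⟩), Submodule.smul_mem _ _ hz⟩
          rw [smul_smul, ← pow_add, show k + 1 + (k + 1) = 2 * k + 2 by ring]
          exact hk z (hle hz)
        exact span_pair_le (key x (Submodule.subset_span (Set.mem_insert x {y})))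
          (key y (Submodule.subset_span (Set.mem_insert_of_mem x rfl)))
      have h1 : finrank K (𝓢 (Submodule.span 𝓡 {𝔫 ^ (k + 1) • x, 𝔫 ^ (k + 1) • y})) ≤
          finrank K (𝓢 (layerSum W ⊓ Submodule.span 𝓡 {x, y})) :=
        Submodule.finrank_mono fun v hv => hS hv
      have h2 := finrank_span_pair_le_add_pow (K := K) x y (k + 1)
      have hbot' : layerSum W ⊓ Submodule.span 𝓡 {x, y} ⊓
          (layerSum W ⊓ (Y ⊓ orthSub Q (Submodule.span 𝓡 {x, y}))) = ⊥ :=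
        eq_bot_iff.2 ((inf_le_inf inf_le_right inf_le_right).trans hbot.le)
      have h3 := finrank_add_eq_of_splitting (K := K) hbot' rfl
      have hle' : layerSum W ⊓ Submodule.span 𝓡 {x, y} ⊔
          (layerSum W ⊓ (Y ⊓ orthSub Q (Submodule.span 𝓡 {x, y}))) ≤ layerSum W ⊓ Y :=
        sup_le (inf_le_inf_left _ hle) (inf_le_inf_left _ inf_le_left)
      have h4 : finrank K (𝓢 (layerSum W ⊓ Submodule.span 𝓡 {x, y} ⊔
          (layerSum W ⊓ (Y ⊓ orthSub Q (Submodule.span 𝓡 {x, y}))))) ≤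
          finrank K (𝓢 (layerSum W ⊓ Y)) := Submodule.finrank_mono fun v hv => hle' hv
      omega
    · obtain ⟨y, hy, hb, -⟩ := exists_isBlock_isReverser_even_rank hY hk hx hx0
      exact absurd hb (hblock k x y)

variable {Q} in
theorem IsReverser.shift_smul {X : Submodule 𝓡 V} {s : V →ₗ[K] V} (hs : IsReverser Q X s) {x : V}
    (hx : x ∈ X) : s (𝔱 • x) = 𝔲 • s x := by
  have hx' := X.smul_mem 𝔱 hx
  have h := congrArg s (hs.rev x hx)
  rw [hs.invol _ (X.smul_mem _ (hs.mem _ hx'))] at h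
  rw [← h, smul_smul, mul_comm, T_one_mul_T_neg_one, one_smul]

variable {Q} in
theorem IsReverser.unipElt_pow_smul {X : Submodule 𝓡 V} {s : V →ₗ[K] V} (hs : IsReverser Q X s)
    {x : V} (hx : x ∈ X) (j : ℕ) : s (𝔫 ^ j • x) = 𝔫 ^ j • (T (-j : ℤ) : 𝓡) • s x := by
  have key : ∀ y ∈ X, s (𝔫 • y) = 𝔫 • 𝔲 • s y := by
    intro y hy
    rw [unipElt, add_smul, one_smul, map_add, hs.shift_smul hy, add_smul, one_smul, smul_smul,
      T_one_mul_T_neg_one, one_smul, add_comm]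
  induction j with
  | zero => simp
  | succ j ih =>
    rw [pow_succ', mul_smul, key _ (X.smul_mem _ hx), ih, mul_smul, smul_comm 𝔲, smul_smul 𝔲,
      ← LaurentPolynomial.T_add]
    congr 4
    push_cast
    ring

variable {Q} in
theorem IsReverser.unipElt_pow_smul_eq_zero {X : Submodule 𝓡 V} {s : V →ₗ[K] V}
    (hs : IsReverser Q X s) {x : V} (hx : x ∈ X) {j : ℕ} (h : 𝔫 ^ j • x = 0) :
    𝔫 ^ j • s x = 0 := by
  have e := hs.unipElt_pow_smul hx j
  rw [h, map_zero, smul_comm] at e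
  have e' := congrArg (fun v => (T (j : ℤ) : 𝓡) • v) e.symm
  simp only [smul_zero, smul_smul (T (j : ℤ) : 𝓡), ← LaurentPolynomial.T_add,
    add_neg_cancel, LaurentPolynomial.T_zero, one_smul] at e'
  exact e'

theorem isReverser_of_shift_eq {s s' : V →ₗ[K] V} (hs : ∀ x, Q (s x) = Q x)
    (hi : ∀ x, s (s x) = x) (hi' : ∀ x, s' (s' x) = x) (h : ∀ x, 𝔱 • x = s (s' x)) :
    IsReverser Q ⊤ s := by
  refine ⟨fun _ _ => trivial, fun x _ => hs x, fun x _ => hi x, fun x _ => ?_⟩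
  rw [h x, hi, h, hi', hi]

/-- Fitting decomposition with respect to `n = t + 1`. -/
theorem exists_fitting (hV : NondegSub Q ⊤) : ∃ (M : ℕ) (V₀ V₁ : Submodule 𝓡 V),
    (∀ x, x ∈ V₀ ↔ ∃ v, 𝔫 ^ M • v = x) ∧ (∀ x, x ∈ V₁ ↔ 𝔫 ^ M • x = 0) ∧ V₀ ⊓ V₁ = ⊥ ∧
      V₀ ⊔ V₁ = ⊤ ∧ NondegSub Q V₁ ∧ ∀ x ∈ V₀, 𝔫 • x = 0 → x = 0 := by
  have : IsNoetherian 𝓡 V := isNoetherian_of_tower K inferInstance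
  have : IsArtinian 𝓡 V := isArtinian_of_tower K inferInstance
  obtain ⟨M, hM1, hM⟩ := ((Filter.eventually_ge_atTop 1).and
    (LinearMap.eventually_isCompl_ker_pow_range_pow
      (Algebra.lsmul 𝓡 𝓡 V 𝔫 : Module.End 𝓡 V))).exists
  rw [← map_pow] at hM
  set V₁ := LinearMap.ker (Algebra.lsmul 𝓡 𝓡 V (𝔫 ^ M)) with hV₁
  set V₀ := LinearMap.range (Algebra.lsmul 𝓡 𝓡 V (𝔫 ^ M)) with hV₀
  have m₀ : ∀ x, x ∈ V₀ ↔ ∃ v, 𝔫 ^ M • v = x := fun x => Iff.rfl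
  have m₁ : ∀ x, x ∈ V₁ ↔ 𝔫 ^ M • x = 0 := fun x => Iff.rfl
  have hb : V₀ ⊓ V₁ = ⊥ := by rw [inf_comm]; exact hM.inf_eq_bot
  have ht : V₀ ⊔ V₁ = ⊤ := by rw [sup_comm]; exact hM.sup_eq_top
  refine ⟨M, V₀, V₁, m₀, m₁, hb, ht, ?_, ?_⟩
  · intro x hx h
    refine hV x trivial fun y _ => ?_
    have hy : y ∈ V₀ ⊔ V₁ := ht ▸ trivial
    obtain ⟨a, ha, b, hb, rfl⟩ := Submodule.mem_sup.1 hy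
    obtain ⟨v, rfl⟩ := (m₀ a).1 ha
    rw [map_add, h b hb, add_zero, polar_comm', polar_smul, invert_unipElt_pow, mul_smul,
      (m₁ x).1 hx, smul_zero, map_zero]
  · intro x hx h
    have : x ∈ V₀ ⊓ V₁ := by
      refine ⟨hx, (m₁ x).2 ?_⟩
      obtain ⟨d, rfl⟩ := Nat.exists_eq_add_of_le' hM1
      rw [pow_succ, mul_smul, h, smul_zero]
    rwa [hb] at this

theorem even_finrank_map_of_layerSum {W : Submodule 𝓡 V} (hW : NondegSub Q W)
    (hc : ∀ (k : ℕ) (x : V), 𝔫 ^ (2 * k + 2) • x = 0 → 𝓑 (𝔫 ^ (2 * k + 1) • x) x = 0)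
    (hd : finrank K (𝓢 W) ≤ 2 * finrank K (𝓢 (layerSum W)))
    {s : V →ₗ[K] V} (hs : IsReverser Q W s) (ht : IsReverser Q ⊤ s) :
    Even (finrank K ((𝓢 W).map (s - LinearMap.id))) := by
  let q : QuadraticForm K (𝓢 W) := Q.comp (𝓢 W).subtype
  have hqB : ∀ x y : 𝓢 W, q.polarBilin x y = 𝓑 (x : V) (y : V) := fun x y => rfl
  have hq : q.polarBilin.Nondegenerate :=
    ⟨fun x h => Subtype.ext (hW x x.2 fun y hy => h ⟨y, hy⟩),
      fun x h => Subtype.ext (hW x x.2 fun y hy => by rw [polar_comm']; exact h ⟨y, hy⟩)⟩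
  let g : 𝓢 W →ₗ[K] 𝓢 W := s.restrict (p := 𝓢 W) (q := 𝓢 W) hs.mem
  let S : Submodule K (𝓢 W) := (𝓢 (layerSum W)).comap (𝓢 W).subtype
  have hS : ∀ x ∈ S, q x = 0 := fun x hx => map_layerSum Q hc hx
  have hfS : finrank K S = finrank K (𝓢 (layerSum W)) :=
    (Submodule.comapSubtypeEquivOfLe (p := 𝓢 (layerSum W)) (q := 𝓢 W)
      fun x hx => layerSum_le W hx).finrank_eq
  have hle : S ≤ LinearMap.BilinForm.orthogonal q.polarBilin S := fun x hx => by
    rw [LinearMap.BilinForm.mem_orthogonal_iff]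
    exact fun y hy => polarBilin_eq_zero_of_singular q hS hy hx
  have h1 := Submodule.finrank_mono hle
  rw [LinearMap.BilinForm.finrank_orthogonal hq] at h1
  have hdS : 2 * finrank K S = finrank K (𝓢 W) := by
    have h2 := Submodule.finrank_le S
    omega
  have hgS : ∀ x ∈ S, g x ∈ S := by
    intro x hx
    have hx' : (x : V) ∈ layerSum W := hx
    change s (x : V) ∈ layerSum W
    refine Submodule.iSup_induction (layer W) (motive := fun x => s x ∈ layerSum W) hx'
      (fun j y hy => ?_) ?_ fun y z hy hz => ?_
    · obtain ⟨hyW, ⟨v, rfl⟩, hv⟩ := mem_layer.1 hy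
      exact Submodule.mem_iSup_of_mem j (mem_layer.2 ⟨hs.mem _ hyW,
        ⟨_, (ht.unipElt_pow_smul trivial j).symm⟩, ht.unipElt_pow_smul_eq_zero trivial hv⟩)
    · rw [map_zero]; exact Submodule.zero_mem _
    · rw [map_add]; exact Submodule.add_mem _ hy hz
  have h3 := even_finrank_ker_of_stable_singular q hq (g := g)
    (fun x => hs.map_form x x.2) hS hdS hgS
  have hk : finrank K (LinearMap.ker (g - LinearMap.id)) =
      finrank K (𝓢 W ⊓ LinearMap.ker (s - LinearMap.id) : Submodule K V) := by
    have e : LinearMap.ker (g - LinearMap.id) =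
        (𝓢 W ⊓ LinearMap.ker (s - LinearMap.id) : Submodule K V).comap (𝓢 W).subtype := by
      ext x
      constructor
      · intro h
        exact ⟨x.2, congrArg Subtype.val h⟩
      · intro h
        exact Subtype.ext h.2
    rw [e]
    exact (Submodule.comapSubtypeEquivOfLe inf_le_left).finrank_eq
  have h4 := Submodule.finrank_map_add_finrank_inf_ker (s - LinearMap.id) (𝓢 W)
  have h5 := hW.even_finrank
  rw [hk] at h3
  rw [Nat.even_iff] at *
  omega

theorem two_mul_finrank_map_le {W : Submodule 𝓡 V} {s : V →ₗ[K] V} (hs : IsReverser Q W s) :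
    2 * finrank K ((𝓢 W).map (s - LinearMap.id)) ≤ finrank K (𝓢 W) := by
  have h := Submodule.finrank_map_add_finrank_inf_ker (s - LinearMap.id) (𝓢 W)
  have hle : (𝓢 W).map (s - LinearMap.id) ≤ 𝓢 W ⊓ LinearMap.ker (s - LinearMap.id) := by
    rintro _ ⟨x, hx, rfl⟩
    refine ⟨W.sub_mem (hs.mem x hx) hx, ?_⟩
    change s (s x - x) - (s x - x) = 0
    rw [map_sub, hs.invol x hx, ← neg_sub (s x) x, sub_eq_zero]
    exact eq_of_add_eq_zero_of_charTwo K (neg_add_cancel _)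
  have := Submodule.finrank_mono hle
  omega

theorem two_mul_finrank_map_eq {W : Submodule 𝓡 V} {s : V →ₗ[K] V} (hs : IsReverser Q W s)
    (hn : ∀ x ∈ W, 𝔫 • x = 0 → x = 0) :
    2 * finrank K ((𝓢 W).map (s - LinearMap.id)) = finrank K (𝓢 W) := by
  let s' : V →ₗ[K] V := s ∘ₗ shiftMap K V
  have hs' : IsReverser Q W s' := hs.comp_shift Q fun _ => rfl
  have h1 := two_mul_finrank_map_le Q hs
  have h2 := two_mul_finrank_map_le Q hs'
  have hle : (𝓢 W).map (unipMap K V) ≤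
      (𝓢 W).map (s - LinearMap.id) ⊔ (𝓢 W).map (s' - LinearMap.id) := by
    rintro _ ⟨x, hx, rfl⟩
    have e : unipMap K V x = (s (s' x) - s' x) + (s' x - x) := by
      change 𝔫 • x = s (s (𝔱 • x)) - s (𝔱 • x) + (s (𝔱 • x) - x)
      rw [hs.invol _ (W.smul_mem _ hx), unipElt, add_smul, one_smul, sub_add_sub_cancel,
        eq_sub_iff_add_eq, add_assoc, add_self_of_charTwo K x, add_zero]
    rw [e]
    exact Submodule.add_mem_sup ⟨s' x, hs'.mem x hx, rfl⟩ ⟨x, hx, rfl⟩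
  have h3 := Submodule.finrank_map_add_finrank_inf_ker (unipMap K V) (𝓢 W)
  have hbot : 𝓢 W ⊓ LinearMap.ker (unipMap K V) = ⊥ :=
    eq_bot_iff.2 fun x hx => (Submodule.mem_bot K).2 (hn x hx.1 hx.2)
  rw [hbot, finrank_bot] at h3
  have h4 := (Submodule.finrank_mono hle).trans (Submodule.finrank_add_le_finrank_add_finrank _ _)
  omega

/-- A bireflectional `t` has a cyclic unipotent summand or a block of even exponent. -/
theorem exists_cyclic_or_isBlock_of_isBireflective (hV : NondegSub Q ⊤)
    (hdim : finrank K V % 4 = 2) (h : IsBireflective Q) :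
    (∃ x : V, x ≠ 0 ∧ (∃ m, 𝔫 ^ m • x = 0) ∧ NondegSub Q (Submodule.span 𝓡 {x})) ∨
      ∃ (k : ℕ) (x y : V), IsBlock Q (2 * k) x y := by
  by_contra hcon
  push Not at hcon
  obtain ⟨hcyc, hblock⟩ := hcon
  have hcyc' : ∀ x : V, x ≠ 0 → (∃ m, 𝔫 ^ m • x = 0) → ¬ NondegSub Q (Submodule.span 𝓡 {x}) :=
    fun x hx hm => hcyc x hx hm
  have hc : ∀ (k : ℕ) (x : V), 𝔫 ^ (2 * k + 2) • x = 0 → 𝓑 (𝔫 ^ (2 * k + 1) • x) x = 0 := by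
    intro k x hx
    by_contra hx'
    refine hcyc' x ?_ ⟨_, hx⟩ (nondegSub_span_singleton_of_unip Q hx hx')
    rintro rfl
    exact hx' (map_zero _)
  obtain ⟨s, s', hs, -, hi, hi', hr, -, ht⟩ := h
  have hrev := isReverser_of_shift_eq Q hs hi hi' ht
  obtain ⟨M, V₀, V₁, m₀, m₁, hbot, htop, hV₁, hV₀⟩ := exists_fitting Q hV
  have h₀ : IsReverser Q V₀ s := by
    refine ⟨fun x hx => ?_, fun x _ => hrev.map_form x trivial, fun x _ => hrev.invol x trivial,
      fun x _ => hrev.rev x trivial⟩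
    obtain ⟨v, rfl⟩ := (m₀ x).1 hx
    exact (m₀ _).2 ⟨_, (hrev.unipElt_pow_smul trivial M).symm⟩
  have h₁ : IsReverser Q V₁ s := by
    refine ⟨fun x hx => ?_, fun x _ => hrev.map_form x trivial, fun x _ => hrev.invol x trivial,
      fun x _ => hrev.rev x trivial⟩
    exact (m₁ _).2 (hrev.unipElt_pow_smul_eq_zero trivial ((m₁ x).1 hx))
  have e := finrank_range_glue hbot htop h₀.mem h₁.mem (s := s) (fun _ _ => rfl) fun _ _ => rfl
  obtain ⟨d1, d4⟩ := finrank_le_two_mul_layerSum Q (fun x hx => (m₁ x).1 hx) hcyc' hblock le_rfl hV₁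
  rw [inf_eq_left.2 (layerSum_le V₁)] at d1
  have r₁ := even_finrank_map_of_layerSum Q hV₁ hc d1 h₁ hrev
  have r₀ := two_mul_finrank_map_eq Q h₀ hV₀
  have d := finrank_add_eq_of_splitting (K := K) hbot htop
  rw [Submodule.restrictScalars_top, finrank_top] at d
  rw [Nat.even_iff] at *
  omega

theorem exists_laurentModule {K V : Type*} [Field K] [AddCommGroup V] [Module K V]
    (φ : V ≃ₗ[K] V) : ∃ _ : Module (LaurentPolynomial K) V,
      IsScalarTower K (LaurentPolynomial K) V ∧ ∀ v : V, (T 1 : LaurentPolynomial K) • v = φ v := by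
  let ρ : LaurentPolynomial K →ₐ[K] Module.End K V :=
    AddMonoidAlgebra.lift K (Module.End K V) ℤ
      ((LinearEquiv.automorphismGroup.toLinearMapMonoidHom (R := K) (M := V)).comp
        (zpowersHom (V ≃ₗ[K] V) φ))
  refine ⟨Module.compHom V ρ.toRingHom, ?_, fun v => ?_⟩
  · let _ : Module (LaurentPolynomial K) V := Module.compHom V ρ.toRingHom
    refine ⟨fun a r v => ?_⟩
    change ρ (a • r) v = a • ρ r v
    rw [map_smul, LinearMap.smul_apply]
  · change ρ (T 1) v = φ v
    have : ρ (T 1) = (φ : V →ₗ[K] V) := by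
      refine (AddMonoidAlgebra.lift_single _ _ _).trans ?_
      rw [one_smul]
      change ((φ ^ (1 : ℤ) : V ≃ₗ[K] V) : V →ₗ[K] V) = _
      rw [zpow_one]
    rw [this]
    rfl

section Translation

variable {φ : V ≃ₗ[K] V} {X : Submodule (LaurentPolynomial K) V}

theorem coe_restrict_sub_id_pow (hφ : ∀ v : V, 𝔱 • v = φ v)
    (hX : ∀ u ∈ 𝓢 X, φ.toLinearMap u ∈ 𝓢 X) (m : ℕ) (u : 𝓢 X) :
    ((((φ.toLinearMap.restrict hX - LinearMap.id : Module.End K (𝓢 X)) ^ m) u : 𝓢 X) : V) = 𝔫 ^ m • (u : V) := by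
  induction m with
  | zero => simp
  | succ m ih =>
    rw [pow_succ', Module.End.mul_apply, pow_succ', mul_smul, ← ih, unipElt, add_smul, hφ,
      one_smul]
    change φ _ - _ = _
    rw [sub_eq_iff_eq_add, add_assoc, LinearMap.id_apply, add_self_of_charTwo K, add_zero]
    rfl

theorem coe_restrict_pow (hφ : ∀ v : V, 𝔱 • v = φ v)
    (hX : ∀ u ∈ 𝓢 X, φ.toLinearMap u ∈ 𝓢 X) (k : ℕ) (u : 𝓢 X) :
    ((((φ.toLinearMap.restrict hX : Module.End K (𝓢 X)) ^ k) u : 𝓢 X) : V) = (T (k : ℤ) : 𝓡) • (u : V) := by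
  induction k with
  | zero => simp
  | succ k ih =>
    rw [pow_succ', Module.End.mul_apply, Nat.cast_succ, add_comm, LaurentPolynomial.T_add,
      mul_smul, ← ih, hφ]
    rfl

theorem isNilpotent_restrict_iff (hφ : ∀ v : V, 𝔱 • v = φ v)
    (hX : ∀ u ∈ 𝓢 X, φ.toLinearMap u ∈ 𝓢 X) :
    IsNilpotent (φ.toLinearMap.restrict hX - LinearMap.id) ↔
    ∃ m, ∀ x ∈ X, 𝔫 ^ m • x = 0 := by
  refine exists_congr fun m => ⟨fun h x hx => ?_, fun h => LinearMap.ext fun u => Subtype.ext ?_⟩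
  · rw [← coe_restrict_sub_id_pow hφ hX m ⟨x, hx⟩, h]
    rfl
  · rw [coe_restrict_sub_id_pow hφ hX, h u u.2]
    rfl

theorem isCyclicEnd_restrict_iff (hφ : ∀ v : V, 𝔱 • v = φ v)
    (hX : ∀ u ∈ 𝓢 X, φ.toLinearMap u ∈ 𝓢 X) :
    IsCyclicEnd (φ.toLinearMap.restrict hX) ↔
    ∃ x, X = Submodule.span 𝓡 {x} := by
  constructor
  · rintro ⟨x, hx⟩
    refine ⟨x, le_antisymm (fun v hv => ?_) ((Submodule.span_singleton_le_iff_mem _ _).2 x.2)⟩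
    have h1 : cyclicSpan (φ.toLinearMap.restrict hX) x ≤
        (𝓢 (Submodule.span 𝓡 {(x : V)})).comap (𝓢 X).subtype := by
      refine Submodule.span_le.2 ?_
      rintro _ ⟨k, rfl⟩
      change (((φ.toLinearMap.restrict hX) ^ k) x : V) ∈ Submodule.span 𝓡 {(x : V)}
      rw [coe_restrict_pow hφ hX]
      exact Submodule.smul_mem _ _ (Submodule.mem_span_singleton_self _)
    rw [hx] at h1
    exact h1 (x := ⟨v, hv⟩) trivial
  · rintro ⟨x, hx⟩
    have hxX : x ∈ X := hx ▸ Submodule.mem_span_singleton_self x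
    refine ⟨⟨x, hxX⟩, eq_top_iff.2 fun v _ => ?_⟩
    have hst : ∀ w ∈ cyclicSpan (φ.toLinearMap.restrict hX) ⟨x, hxX⟩,
        φ.toLinearMap.restrict hX w ∈ cyclicSpan (φ.toLinearMap.restrict hX) ⟨x, hxX⟩ := by
      intro w hw
      refine Submodule.span_induction (p := fun w _ => φ.toLinearMap.restrict hX w ∈
        cyclicSpan (φ.toLinearMap.restrict hX) ⟨x, hxX⟩) ?_ ?_ ?_ ?_ hw
      · rintro _ ⟨k, rfl⟩
        exact Submodule.subset_span ⟨k + 1, by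
          simp only [pow_succ' (φ.toLinearMap.restrict hX) k, Module.End.mul_apply]⟩
      · rw [map_zero]; exact Submodule.zero_mem _
      · intro a b _ _ ha hb
        rw [map_add]; exact Submodule.add_mem _ ha hb
      · intro c a _ ha
        rw [map_smul]; exact Submodule.smul_mem _ _ ha
    obtain ⟨Y, hY⟩ := exists_restrictScalars_eq
      ((cyclicSpan (φ.toLinearMap.restrict hX) ⟨x, hxX⟩).map (𝓢 X).subtype) (by
        rintro _ ⟨w, hw, rfl⟩
        exact ⟨_, hst w hw, (hφ w).symm⟩)
    have hxY : x ∈ 𝓢 Y := by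
      rw [hY]
      exact ⟨⟨x, hxX⟩, Submodule.subset_span ⟨0, by simp⟩, rfl⟩
    have hvY : (v : V) ∈ 𝓢 Y := by
      have : Submodule.span 𝓡 {x} ≤ Y := (Submodule.span_singleton_le_iff_mem _ _).2 hxY
      exact this (hx ▸ v.2)
    rw [hY] at hvY
    obtain ⟨w, hw, hwv⟩ := hvY
    rwa [Subtype.ext hwv] at hw

theorem eq_of_le_of_orthIndec (hφ : ∀ v : V, 𝔱 • v = φ v)
    (hX : ∀ u ∈ 𝓢 X, φ.toLinearMap u ∈ 𝓢 X)
    (h : OrthIndec (Q.comp (𝓢 X).subtype) (φ.toLinearMap.restrict hX)) {W : Submodule 𝓡 V}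
    (hWX : W ≤ X) (hW : NondegSub Q W) (hW0 : W ≠ ⊥) : W = X := by
  by_contra hne
  have hf : finrank K ((𝓢 W).comap (𝓢 X).subtype) = finrank K (𝓢 W) :=
    (Submodule.comapSubtypeEquivOfLe (p := 𝓢 W) (q := 𝓢 X) fun x hx => hWX hx).finrank_eq
  refine h ⟨(𝓢 W).comap (𝓢 X).subtype, fun u hu => ?_, ?_, ?_, fun u hu huw => ?_⟩
  · change φ u ∈ W
    rw [← hφ]
    exact W.smul_mem _ hu
  · rw [hf]
    exact finrank_pos_of_ne_bot hW0
  · rw [hf]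
    refine Submodule.finrank_lt_finrank_of_lt (lt_of_le_of_ne (fun x hx => hWX hx) fun e => ?_)
    exact hne (Submodule.restrictScalars_injective K _ _ e)
  · exact Subtype.ext (hW u hu fun y hy => huw ⟨y, hWX hy⟩ hy)

theorem orthIndec_of_forall_eq (hφ : ∀ v : V, 𝔱 • v = φ v)
    (hX : ∀ u ∈ 𝓢 X, φ.toLinearMap u ∈ 𝓢 X)
    (h : ∀ W ≤ X, NondegSub Q W → W ≠ ⊥ → W = X) :
    OrthIndec (Q.comp (𝓢 X).subtype) (φ.toLinearMap.restrict hX) := by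
  rintro ⟨W, hW, hpos, hlt, hnd⟩
  obtain ⟨Y, hY⟩ := exists_restrictScalars_eq (W.map (𝓢 X).subtype) (by
    rintro _ ⟨w, hw, rfl⟩
    exact ⟨_, hW w hw, (hφ w).symm⟩)
  have hf : finrank K (𝓢 Y) = finrank K W := by
    rw [hY]
    exact Submodule.finrank_map_subtype_eq _ _
  have hm : ∀ v, v ∈ Y ↔ ∃ w ∈ W, (w : V) = v := fun v => by
    have : v ∈ Y ↔ v ∈ 𝓢 Y := Iff.rfl
    rw [this, hY]
    rfl
  have hYX : Y = X := by
    refine h Y (fun v hv => ?_) (fun v hv hvv => ?_) fun e => ?_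
    · obtain ⟨w, -, rfl⟩ := (hm v).1 hv
      exact w.2
    · obtain ⟨w, hw, rfl⟩ := (hm v).1 hv
      rw [hnd w hw fun y hy => hvv y ((hm _).2 ⟨y, hy, rfl⟩)]
      rfl
    · rw [e, Submodule.restrictScalars_bot, finrank_bot] at hf
      omega
  rw [hYX] at hf
  omega

theorem bireflSO_iff_isBireflective (hφ : ∀ v : V, 𝔱 • v = φ v) :
    BireflSO Q φ ↔ IsBireflective Q := by
  constructor
  · rintro ⟨σ, τ, ⟨hσ, hσ'⟩, ⟨hτ, hτ'⟩, hσσ, hττ, rfl⟩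
    exact ⟨σ, τ, hσ, hτ, LinearEquiv.congr_fun hσσ, LinearEquiv.congr_fun hττ, hσ', hτ', hφ⟩
  · rintro ⟨s, s', hs, hs', hi, hi', hr, hr', h⟩
    refine ⟨LinearEquiv.ofInvolutive s hi, LinearEquiv.ofInvolutive s' hi', ⟨hs, hr⟩, ⟨hs', hr'⟩,
      LinearEquiv.ext hi, LinearEquiv.ext hi', LinearEquiv.ext fun v => ?_⟩
    rw [← hφ v, h]
    rfl

theorem isBireflective_iff (hφ : ∀ v : V, 𝔱 • v = φ v) (hV : NondegSub Q ⊤) (hdim : finrank K V % 4 = 2)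
    (hr : Even (finrank K (LinearMap.range (φ.toLinearMap - LinearMap.id)))) :
    IsBireflective Q ↔ ∃ (U : Submodule K V) (hU : ∀ u ∈ U, φ.toLinearMap u ∈ U), U ≠ ⊥ ∧
      NondegOn Q U ∧ IsNilpotent (φ.toLinearMap.restrict hU - LinearMap.id) ∧
      (IsCyclicEnd (φ.toLinearMap.restrict hU) ∨
        (OrthIndec (Q.comp U.subtype) (φ.toLinearMap.restrict hU) ∧ finrank K U % 4 = 2)) := by
  have hstab : ∀ Y : Submodule 𝓡 V, ∀ u ∈ 𝓢 Y, φ.toLinearMap u ∈ 𝓢 Y := fun Y u hu => by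
    have : 𝔱 • u ∈ Y := Y.smul_mem _ hu
    rwa [hφ] at this
  have hshift : φ.toLinearMap = shiftMap K V := LinearMap.ext fun v => (hφ v).symm
  constructor
  · intro h
    obtain ⟨x, hx, ⟨m, hm⟩, hnd⟩ | ⟨k, x, y, hb⟩ :=
      exists_cyclic_or_isBlock_of_isBireflective Q hV hdim h
    · refine ⟨𝓢 (Submodule.span 𝓡 {x}), hstab _, ?_, hnd,
        (isNilpotent_restrict_iff hφ (hstab _)).2 ⟨m, fun v hv => ?_⟩,
        Or.inl ((isCyclicEnd_restrict_iff hφ (hstab _)).2 ⟨x, rfl⟩)⟩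
      · rw [Ne, Submodule.restrictScalars_eq_bot_iff, Submodule.span_singleton_eq_bot]
        exact hx
      · obtain ⟨r, rfl⟩ := Submodule.mem_span_singleton.1 hv
        rw [smul_comm, hm, smul_zero]
    · refine ⟨𝓢 (Submodule.span 𝓡 {x, y}), hstab _, ?_, hb.nondegSub,
        (isNilpotent_restrict_iff hφ (hstab _)).2 ⟨2 * k + 1, fun v hv =>
          unipElt_pow_smul_eq_zero_of_mem_span_pair hb.pow_left hb.pow_right hv⟩,
        Or.inr ⟨orthIndec_of_forall_eq Q hφ (hstab _) fun W => hb.eq_of_le, ?_⟩⟩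
      · intro h0
        have := hb.finrank_eq
        rw [h0, finrank_bot] at this
        omega
      · rw [hb.finrank_eq]
        omega
  · rintro ⟨U, hU, hU0, hnd, hnil, hor⟩
    obtain ⟨Y, rfl⟩ := exists_restrictScalars_eq U fun u hu => by
      rw [hφ]; exact hU u hu
    rw [hshift] at hr
    have hY0 : Y ≠ ⊥ := fun h => hU0 (by rw [h]; rfl)
    have hn := (isNilpotent_restrict_iff hφ hU).1 hnil
    rcases hor with hcyc | ⟨hind, hd⟩
    · obtain ⟨x, rfl⟩ := (isCyclicEnd_restrict_iff hφ hU).1 hcyc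
      exact isBireflective_of_cyclic Q hV hr
        (fun h => hY0 (Submodule.span_singleton_eq_bot.2 h)) hnd hn
    · exact isBireflective_of_indecomposable Q hV hr hY0 hnd hn
        (fun W hWY hW hW0 => eq_of_le_of_orthIndec Q hφ hU hind hWY hW hW0) hd

end Translation

end LaurentModules

theorem stmt3 [Field K] [AddCommGroup V] [Module K V] [FiniteDimensional K V]
    (Q : QuadraticForm K V) (hQ : Nondefective Q)
    (hchar : ringChar K = 2) (hdim : Module.finrank K V % 4 = 2)
    (φ : V ≃ₗ[K] V) (hφ : InSO Q φ) :
    BireflSO Q φ ↔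
      ∃ (U : Submodule K V) (hU : ∀ u ∈ U, φ.toLinearMap u ∈ U),
        U ≠ ⊥ ∧ NondegOn Q U ∧
        IsNilpotent (φ.toLinearMap.restrict hU - LinearMap.id) ∧
        (IsCyclicEnd (φ.toLinearMap.restrict hU) ∨
          (OrthIndec (Q.comp U.subtype) (φ.toLinearMap.restrict hU) ∧
            Module.finrank K U % 4 = 2)) := by
  have : CharP K 2 := ringChar.of_eq hchar
  obtain ⟨m, tower, hm⟩ := exists_laurentModule φ
  have : ShiftInvariant Q := ⟨fun v => by rw [hm]; exact hφ.1 v⟩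
  have hV : NondegSub Q ⊤ := fun x _ h => hQ x fun w => h w trivial
  rw [bireflSO_iff_isBireflective Q hm]
  exact isBireflective_iff Q hm hV hdim hφ.2
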